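/- Let (λ_i)_{i≥1} be a sequence of points in the bidisc 𝔻². The following are equivalent: (i) for every bounded sequence (w_i) of complex numbers there exists a bounded holomorphic function f : 𝔻² → ℂ with f(λ_i) = w_i for all i; (ii) there exist constants M > 0 and N > 0 such that for every admissible kernel k on 𝔻² and every finitely supported complex sequence (α_i), N·Σ_i |α_i|² ≤ Σ_{i,j} conj(α_i)·α_j·G^k_{ij} ≤ M·Σ_i |α_i|²; (iii) the sequence (λ_i) is strongly separated and there exists M > 0 such that Σ_{i,j} conj(α_i)·α_j·G^k_{ij} ≤ M·Σ_i |α_i|² for every admissible kernel k and every finitely supported (α_i); (iv) there exists N > 0 such that Σ_{i,j} conj(α_i)·α_j·G^k_{ij} ≥ N·Σ_i |α_i|² for every admissible kernel k and every finitely supported (α_i). -/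

import Mathlib

open scoped ComplexOrder

noncomputable section

/-- The open unit bidisc in `ℂ × ℂ`. -/
def biDisc : Set (ℂ × ℂ) := {z : ℂ × ℂ | ‖z.1‖ < 1 ∧ ‖z.2‖ < 1}

/-- A kernel `k` is positive semidefinite on the set `S`. -/
def PSDKernelOn {X : Type*} (S : Set X) (k : X → X → ℂ) : Prop :=
  ∀ (n : ℕ) (x : Fin n → X), (∀ i, x i ∈ S) → ∀ c : Fin n → ℂ,
    0 ≤ ∑ i, ∑ j, (starRingEnd ℂ) (c i) * c j * k (x i) (x j)

/-- A kernel on the bidisc is admissible for the sequence `Λ`: it is positive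
semidefinite, multiplication by each coordinate function is a contraction on the
associated reproducing kernel Hilbert space, and the values at the points `Λ i`
are positive. -/
def Admissible2 (Λ : ℕ → ℂ × ℂ) (k : ℂ × ℂ → ℂ × ℂ → ℂ) : Prop :=
  PSDKernelOn biDisc k ∧
  PSDKernelOn biDisc (fun z w => (1 - z.1 * (starRingEnd ℂ) w.1) * k z w) ∧
  PSDKernelOn biDisc (fun z w => (1 - z.2 * (starRingEnd ℂ) w.2) * k z w) ∧
  ∀ i, 0 < k (Λ i) (Λ i)

/-- The normalized Gramian of the kernel `k` at the points `Λ`. -/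
def Gram2 (Λ : ℕ → ℂ × ℂ) (k : ℂ × ℂ → ℂ × ℂ → ℂ) (i j : ℕ) : ℂ :=
  k (Λ i) (Λ j) / (Real.sqrt ((k (Λ i) (Λ i)).re * (k (Λ j) (Λ j)).re) : ℂ)

open Filter Topology

/-- Taylor expansion of a bounded holomorphic function on the unit disc. -/
lemma exists_taylor_disc {g : ℂ → ℂ} {B : ℝ} (hg : DifferentiableOn ℂ g (Metric.ball 0 1))
    (hB : ∀ z, ‖z‖ < 1 → ‖g z‖ ≤ B) :
    ∃ a : ℕ → ℂ, (∀ m, ‖a m‖ ≤ B) ∧ ∀ z, ‖z‖ < 1 → HasSum (fun m => a m * z ^ m) (g z) := by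
  refine ⟨fun m => (m.factorial : ℂ)⁻¹ * iteratedDeriv m g 0, fun m => ?_, fun z hz => ?_⟩
  · have key : ∀ r : ℝ, r ∈ Set.Ioo (0 : ℝ) 1 →
        ‖(m.factorial : ℂ)⁻¹ * iteratedDeriv m g 0‖ ≤ B / r ^ m := by
      intro r hr
      have h := Complex.norm_iteratedDeriv_le_of_forall_mem_sphere_norm_le (c := (0 : ℂ)) (R := r)
        (C := B) (f := g) m hr.1 ?_ ?_
      · rw [norm_mul, norm_inv, Complex.norm_natCast, inv_mul_le_iff₀ (by positivity)]
        calc _ ≤ _ := h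
          _ = _ := by ring
      · apply DifferentiableOn.diffContOnCl
        rw [closure_ball _ hr.1.ne']
        exact hg.mono (Metric.closedBall_subset_ball hr.2)
      · intro z hz
        apply hB
        simp only [mem_sphere_iff_norm, sub_zero] at hz
        rw [hz]; exact hr.2
    have ht : Tendsto (fun r : ℝ => B / r ^ m) (𝓝[<] 1) (𝓝 (B / 1 ^ m)) := by
      apply Tendsto.mono_left _ nhdsWithin_le_nhds
      exact (ContinuousAt.div continuousAt_const (continuousAt_id.pow m) (by simp)).tendsto
    have := ge_of_tendsto ht (b := ‖(m.factorial : ℂ)⁻¹ * iteratedDeriv m g 0‖) ?_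
    · simpa using this
    · filter_upwards [Ioo_mem_nhdsLT (show (0 : ℝ) < 1 by norm_num)] with r hr using key r hr
  · have h := Complex.hasSum_taylorSeries_on_ball hg (z := z) (by simpa using hz)
    simp only [sub_zero, smul_eq_mul] at h
    have e : (fun m => (m.factorial : ℂ)⁻¹ * iteratedDeriv m g 0 * z ^ m) =
        fun m => (m.factorial : ℂ)⁻¹ * (z ^ m * iteratedDeriv m g 0) := by
      funext m; ring
    rw [e]
    exact h

lemma geom_tail_bound {a : ℕ → ℂ} {B : ℝ} (ha : ∀ m, ‖a m‖ ≤ B) {t s : ℂ} (ht : ‖t‖ < 1)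
    (hs : HasSum (fun m => a m * t ^ m) s) (j : ℕ) :
    ‖s - ∑ m ∈ Finset.range j, a m * t ^ m‖ ≤ B * ‖t‖ ^ j * (1 - ‖t‖)⁻¹ := by
  have h1 := (hasSum_nat_add_iff' j).mpr hs
  have h2 : HasSum (fun m => B * ‖t‖ ^ j * ‖t‖ ^ m) (B * ‖t‖ ^ j * (1 - ‖t‖)⁻¹) :=
    (hasSum_geometric_of_lt_one (norm_nonneg _) ht).mul_left _
  refine h1.norm_le_of_bounded h2 fun m => ?_
  rw [norm_mul, norm_pow, pow_add]
  have := mul_le_mul_of_nonneg_right (ha (m + j)) (show 0 ≤ ‖t‖ ^ m * ‖t‖ ^ j by positivity)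
  linarith

/-- Taylor expansion of a bounded holomorphic function on the bidisc. -/
lemma exists_taylor_biDisc {f : ℂ × ℂ → ℂ} {B : ℝ} (hf : DifferentiableOn ℂ f biDisc)
    (hB : ∀ z ∈ biDisc, ‖f z‖ ≤ B) :
    ∃ a : ℕ × ℕ → ℂ, (∀ p, ‖a p‖ ≤ B) ∧
      ∀ z ∈ biDisc, HasSum (fun p => a p * (z.1 ^ p.1 * z.2 ^ p.2)) (f z) := by
  have h1 : ∀ y : ℂ, ∃ a : ℕ → ℂ, ‖y‖ < 1 → (∀ m, ‖a m‖ ≤ B) ∧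
      ∀ z, ‖z‖ < 1 → HasSum (fun m => a m * z ^ m) (f (z, y)) := by
    intro y
    by_cases hy : ‖y‖ < 1
    · have hd : DifferentiableOn ℂ (fun z => f (z, y)) (Metric.ball 0 1) := by
        refine hf.comp (by fun_prop) ?_
        intro z hz
        exact ⟨by simpa using hz, hy⟩
      obtain ⟨a, ha⟩ := exists_taylor_disc hd (B := B) fun z hz => hB _ ⟨hz, hy⟩
      exact ⟨a, fun _ => ha⟩
    · exact ⟨0, fun h => absurd h hy⟩
  choose A hA using h1
  have hB0 : 0 ≤ B := le_trans (norm_nonneg _) (hB 0 (by simp [biDisc]))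
  have hslice : ∀ t : ℂ, ‖t‖ < 1 → DifferentiableOn ℂ (fun y => f (t, y)) (Metric.ball 0 1) := by
    intro t ht
    refine hf.comp (by fun_prop) ?_
    intro z hz
    exact ⟨ht, by simpa using hz⟩
  have hdiff : ∀ j, DifferentiableOn ℂ (fun y => A y j) (Metric.ball 0 1) := by
    intro j
    induction j using Nat.strong_induction_on with
    | _ j ih =>
      let t : ℕ → ℂ := fun n => ((n : ℂ) + 2)⁻¹
      have htn : ∀ n, ‖t n‖ = ((n : ℝ) + 2)⁻¹ := by
        intro n
        simp only [t, norm_inv]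
        congr 1
        have : ((n : ℂ) + 2) = ((n + 2 : ℕ) : ℂ) := by push_cast; ring
        rw [this, Complex.norm_natCast]; push_cast; ring
      have htle : ∀ n, ‖t n‖ ≤ 1 / 2 := by
        intro n
        rw [htn, one_div]
        exact inv_anti₀ (by norm_num) (by linarith [(Nat.cast_nonneg n : (0:ℝ) ≤ n)])
      have ht1 : ∀ n, ‖t n‖ < 1 := fun n => lt_of_le_of_lt (htle n) (by norm_num)
      have ht0 : ∀ n, t n ≠ 0 := by
        intro n h
        have := htn n
        rw [h, norm_zero] at this
        have h2 : (0:ℝ) < ((n : ℝ) + 2)⁻¹ := by positivity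
        linarith
      have hlim : Tendsto (fun n => B * ‖t n‖ * 2) atTop (𝓝 0) := by
        have : Tendsto (fun n : ℕ => ((n : ℝ) + 2)⁻¹) atTop (𝓝 0) :=
          (tendsto_atTop_add_const_right _ _ tendsto_natCast_atTop_atTop).inv_tendsto_atTop
        simp_rw [htn]
        simpa using (this.const_mul B).mul_const 2
      refine TendstoLocallyUniformlyOn.differentiableOn (φ := atTop)
        (F := fun n y => (t n ^ j)⁻¹ * (f (t n, y) - ∑ m ∈ Finset.range j, A y m * t n ^ m))
        ?_ ?_ Metric.isOpen_ball
      · apply TendstoUniformlyOn.tendstoLocallyUniformlyOn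
        rw [Metric.tendstoUniformlyOn_iff]
        intro ε hε
        filter_upwards [hlim.eventually_lt_const hε] with n hn y hy
        have hy' : ‖y‖ < 1 := by simpa using hy
        refine lt_of_le_of_lt ?_ hn
        have h := geom_tail_bound (hA y hy').1 (ht1 n) ((hA y hy').2 _ (ht1 n)) (j + 1)
        rw [Finset.sum_range_succ] at h
        rw [dist_comm, dist_eq_norm]
        have e : (t n ^ j)⁻¹ * (f (t n, y) - ∑ m ∈ Finset.range j, A y m * t n ^ m) - A y j
            = (t n ^ j)⁻¹ * (f (t n, y) - (∑ m ∈ Finset.range j, A y m * t n ^ m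
              + A y j * t n ^ j)) := by
          have := pow_ne_zero j (ht0 n)
          field_simp
          ring
        rw [e, norm_mul, norm_inv, norm_pow]
        have hpos : 0 < ‖t n‖ ^ j := pow_pos (norm_pos_iff.mpr (ht0 n)) j
        rw [inv_mul_le_iff₀ hpos]
        refine h.trans ?_
        have h3 : (1 - ‖t n‖)⁻¹ ≤ 2 := by
          rw [inv_le_comm₀ (by linarith [htle n]) (by norm_num)]
          linarith [htle n]
        calc B * ‖t n‖ ^ (j + 1) * (1 - ‖t n‖)⁻¹ ≤ B * ‖t n‖ ^ (j + 1) * 2 := by gcongr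
          _ = _ := by ring
      · refine Eventually.of_forall fun n => ?_
        refine DifferentiableOn.const_mul ((hslice _ (ht1 n)).sub ?_) _
        refine DifferentiableOn.fun_sum fun m hm => ?_
        exact (ih m (Finset.mem_range.mp hm)).mul_const _
  have h2 : ∀ m, ∃ b : ℕ → ℂ, (∀ k, ‖b k‖ ≤ B) ∧
      ∀ y, ‖y‖ < 1 → HasSum (fun k => b k * y ^ k) (A y m) := fun m =>
    exists_taylor_disc (hdiff m) fun y hy => (hA y hy).1 m
  choose b hb using h2
  refine ⟨fun p => b p.1 p.2, fun p => (hb p.1).1 p.2, fun z hz => ?_⟩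
  have hsum : Summable (fun p : ℕ × ℕ => b p.1 p.2 * (z.1 ^ p.1 * z.2 ^ p.2)) := by
    have hs : Summable (fun p : ℕ × ℕ => B * (‖z.1‖ ^ p.1 * ‖z.2‖ ^ p.2)) :=
      ((summable_geometric_of_lt_one (norm_nonneg _) hz.1).mul_of_nonneg
        (summable_geometric_of_lt_one (norm_nonneg _) hz.2) (fun _ => by positivity)
        (fun _ => by positivity)).mul_left B
    refine Summable.of_norm_bounded hs fun p => ?_
    rw [norm_mul, norm_mul, norm_pow, norm_pow]
    gcongr
    exact (hb p.1).1 p.2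
  have h3 : HasSum (fun m => A z.2 m * z.1 ^ m) (∑' p : ℕ × ℕ, b p.1 p.2 * (z.1 ^ p.1 * z.2 ^ p.2)) := by
    refine hsum.hasSum.prod_fiberwise fun m => ?_
    have e : (fun k => b m k * (z.1 ^ m * z.2 ^ k)) = fun k => b m k * z.2 ^ k * z.1 ^ m := by
      funext k; ring
    simp only [e]
    exact ((hb m).2 z.2 hz.2).mul_right (z.1 ^ m)
  have h4 := h3.unique ((hA z.2 hz.2).2 z.1 hz.1)
  rw [← h4]
  exact hsum.hasSum

lemma summable_biDisc_geometric {B : ℝ} {z : ℂ × ℂ} (hz : z ∈ biDisc) :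
    Summable (fun p : ℕ × ℕ => B * (‖z.1‖ ^ p.1 * ‖z.2‖ ^ p.2)) :=
  ((summable_geometric_of_lt_one (norm_nonneg _) hz.1).mul_of_nonneg
    (summable_geometric_of_lt_one (norm_nonneg _) hz.2) (fun _ => by positivity)
    (fun _ => by positivity)).mul_left B

lemma biDisc_eq_ball : biDisc = Metric.ball (0 : ℂ × ℂ) 1 := by
  ext z
  simp [biDisc, Prod.norm_def]

/-- A power series with bounded coefficients is holomorphic on the bidisc. -/
lemma differentiableOn_tsum_biDisc {a : ℕ × ℕ → ℂ} {B : ℝ} (ha : ∀ p, ‖a p‖ ≤ B) :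
    DifferentiableOn ℂ (fun z : ℂ × ℂ => ∑' p : ℕ × ℕ, a p * (z.1 ^ p.1 * z.2 ^ p.2)) biDisc := by
  have hB0 : 0 ≤ B := le_trans (norm_nonneg _) (ha 0)
  intro z hz
  have hz' : ‖z‖ < 1 := by rw [biDisc_eq_ball] at hz; simpa using hz
  obtain ⟨r, hr1, hr2⟩ := exists_between hz'
  have hr0 : 0 < r := lt_of_le_of_lt (norm_nonneg _) hr1
  have hgeo : Summable (fun n : ℕ => r ^ n) := summable_geometric_of_lt_one hr0.le hr2
  have hgeo' : Summable (fun n : ℕ => (n : ℝ) * r ^ (n - 1)) := by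
    have h := summable_pow_mul_geometric_of_norm_lt_one 1 (r := r)
      (by rwa [Real.norm_of_nonneg hr0.le])
    have h2 := h.mul_right r⁻¹
    refine (summable_congr fun n => ?_).mp h2
    cases n with
    | zero => simp
    | succ n => simp only [Nat.add_sub_cancel, pow_succ]; field_simp
  let f' : ℕ × ℕ → ℂ × ℂ → (ℂ × ℂ →L[ℂ] ℂ) := fun p x =>
    a p • (x.1 ^ p.1 • (((p.2 : ℂ) * x.2 ^ (p.2 - 1)) • ContinuousLinearMap.snd ℂ ℂ ℂ)
      + x.2 ^ p.2 • (((p.1 : ℂ) * x.1 ^ (p.1 - 1)) • ContinuousLinearMap.fst ℂ ℂ ℂ))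
  let u : ℕ × ℕ → ℝ := fun p =>
    B * (r ^ p.1 * ((p.2 : ℝ) * r ^ (p.2 - 1)) + ((p.1 : ℝ) * r ^ (p.1 - 1)) * r ^ p.2)
  have hu : Summable u :=
    ((hgeo.mul_of_nonneg hgeo' (fun _ => by positivity) (fun _ => by positivity)).add
      (hgeo'.mul_of_nonneg hgeo (fun _ => by positivity) (fun _ => by positivity))).mul_left B
  have := hasFDerivAt_tsum_of_isPreconnected (𝕜 := ℂ) (u := u)
    (f := fun (p : ℕ × ℕ) (z : ℂ × ℂ) => a p * (z.1 ^ p.1 * z.2 ^ p.2)) (f' := f')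
    (s := Metric.ball 0 r) (x₀ := 0) (x := z) hu Metric.isOpen_ball
    (convex_ball _ _).isPreconnected ?_ ?_ (by simpa using hr0) ?_ (by simpa using hr1)
  · exact this.differentiableAt.differentiableWithinAt
  · intro p x _
    have h1 : HasFDerivAt (fun z : ℂ × ℂ => z.1 ^ p.1)
        (((p.1 : ℂ) * x.1 ^ (p.1 - 1)) • ContinuousLinearMap.fst ℂ ℂ ℂ) x := by
      have := (hasFDerivAt_fst (𝕜 := ℂ) (E := ℂ) (F := ℂ) (p := x)).pow p.1
      simpa [nsmul_eq_mul, smul_smul] using this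
    have h2 : HasFDerivAt (fun z : ℂ × ℂ => z.2 ^ p.2)
        (((p.2 : ℂ) * x.2 ^ (p.2 - 1)) • ContinuousLinearMap.snd ℂ ℂ ℂ) x := by
      have := (hasFDerivAt_snd (𝕜 := ℂ) (E := ℂ) (F := ℂ) (p := x)).pow p.2
      simpa [nsmul_eq_mul, smul_smul] using this
    exact (h1.mul h2).const_mul (a p)
  · intro p x hx
    have hx' : ‖x‖ ≤ r := by simpa using (le_of_lt (by simpa using hx))
    have hx1 : ‖x.1‖ ≤ r := (norm_fst_le x).trans hx'
    have hx2 : ‖x.2‖ ≤ r := (norm_snd_le x).trans hx'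
    simp only [f', u]
    rw [norm_smul]
    refine mul_le_mul (ha p) ?_ (norm_nonneg _) hB0
    refine (norm_add_le _ _).trans ?_
    rw [norm_smul, norm_smul, norm_smul, norm_smul, norm_mul, norm_mul, norm_pow, norm_pow,
      norm_pow, norm_pow, Complex.norm_natCast, Complex.norm_natCast]
    have e1 := ContinuousLinearMap.norm_fst_le ℂ ℂ ℂ
    have e2 := ContinuousLinearMap.norm_snd_le ℂ ℂ ℂ
    calc _ ≤ r ^ p.1 * ((p.2 : ℝ) * r ^ (p.2 - 1) * 1) + r ^ p.2 * ((p.1 : ℝ) * r ^ (p.1 - 1) * 1) := by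
          gcongr
      _ = _ := by ring
  · have : (0 : ℂ × ℂ) ∈ biDisc := by simp [biDisc]
    refine Summable.of_norm_bounded (summable_biDisc_geometric (B := B) this) fun p => ?_
    rw [norm_mul, norm_mul, norm_pow, norm_pow]
    gcongr
    exact ha p

/-- Montel's theorem on the bidisc, in ultrafilter form. -/
lemma montel_biDisc {ι : Type*} (U : Ultrafilter ι) {f : ι → ℂ × ℂ → ℂ} {B : ℝ}
    (hf : ∀ n, DifferentiableOn ℂ (f n) biDisc) (hB : ∀ n, ∀ z ∈ biDisc, ‖f n z‖ ≤ B) :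
    ∃ g : ℂ × ℂ → ℂ, DifferentiableOn ℂ g biDisc ∧ (∀ z ∈ biDisc, ‖g z‖ ≤ B) ∧
      ∀ z ∈ biDisc, Tendsto (fun n => f n z) U (𝓝 (g z)) := by
  choose a ha using fun n => exists_taylor_biDisc (hf n) (hB n)
  have hlim : ∀ p, ∃ c : ℂ, ‖c‖ ≤ B ∧ Tendsto (fun n => a n p) U (𝓝 c) := by
    intro p
    obtain ⟨c, hc, h⟩ := (isCompact_closedBall (0 : ℂ) B).ultrafilter_le_nhds
      (U.map fun n => a n p : Ultrafilter ℂ) (by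
        rw [Filter.le_principal_iff]
        exact Ultrafilter.mem_map.mpr (Filter.univ_mem' fun n => by simpa using (ha n).1 p))
    exact ⟨c, by simpa using hc, h⟩
  choose c hc1 hc2 using hlim
  have ht : ∀ z ∈ biDisc, Tendsto (fun n => f n z) U
      (𝓝 (∑' p : ℕ × ℕ, c p * (z.1 ^ p.1 * z.2 ^ p.2))) := by
    intro z hz
    have := tendsto_tsum_of_dominated_convergence (𝓕 := (U : Filter ι))
      (f := fun n (p : ℕ × ℕ) => a n p * (z.1 ^ p.1 * z.2 ^ p.2))
      (g := fun p => c p * (z.1 ^ p.1 * z.2 ^ p.2)) (summable_biDisc_geometric (B := B) hz)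
      (fun p => (hc2 p).mul_const _) (Eventually.of_forall fun n p => by
        rw [norm_mul, norm_mul, norm_pow, norm_pow]
        gcongr
        exact (ha n).1 p)
    refine this.congr fun n => ?_
    exact ((ha n).2 z hz).tsum_eq
  refine ⟨_, differentiableOn_tsum_biDisc hc1, fun z hz => ?_, ht⟩
  exact le_of_tendsto (ht z hz).norm (Eventually.of_forall fun n => hB n z hz)

open Finset in
lemma parseval_zmod {V : Type*} [NormedAddCommGroup V] [InnerProductSpace ℂ V] (L : ℕ) [NeZero L]
    (y : ZMod L → V) :
    ∑ s : ZMod L, ‖∑ a : ZMod L, ZMod.stdAddChar (s * a) • y a‖ ^ 2 = L * ∑ a, ‖y a‖ ^ 2 := by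
  have key : ∀ s : ZMod L, ((‖∑ a : ZMod L, ZMod.stdAddChar (s * a) • y a‖ ^ 2 : ℝ) : ℂ) =
      ∑ a, ∑ b, ZMod.stdAddChar (s * (b - a)) * inner ℂ (y a) (y b) := by
    intro s
    have e : ∀ v : V, ((‖v‖ ^ 2 : ℝ) : ℂ) = inner ℂ v v := fun v => by
      rw [inner_self_eq_norm_sq_to_K]; push_cast; rfl
    rw [e, sum_inner]
    refine sum_congr rfl fun a _ => ?_
    rw [inner_sum]
    refine sum_congr rfl fun b _ => ?_
    rw [inner_smul_left, inner_smul_right, ← AddChar.map_neg_eq_conj, ← mul_assoc,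
      ← AddChar.map_add_eq_mul]
    congr 2
    ring
  have : ((∑ s : ZMod L, ‖∑ a : ZMod L, ZMod.stdAddChar (s * a) • y a‖ ^ 2 : ℝ) : ℂ)
      = ((L * ∑ a, ‖y a‖ ^ 2 : ℝ) : ℂ) := by
    rw [Complex.ofReal_sum]
    simp_rw [key]
    rw [sum_comm]
    push_cast
    rw [mul_sum]
    refine sum_congr rfl fun a _ => ?_
    rw [sum_comm]
    simp_rw [← sum_mul, AddChar.sum_mulShift _ (ZMod.isPrimitive_stdAddChar L), sub_eq_zero]
    rw [sum_eq_single a]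
    · simp [ZMod.card, inner_self_eq_norm_sq_to_K]
    · intro b _ hb
      simp [hb]
    · simp
  exact_mod_cast this

open Finset in
lemma parseval_zmod_prod {V : Type*} [NormedAddCommGroup V] [InnerProductSpace ℂ V] (L : ℕ)
    [NeZero L] (y : ZMod L → ZMod L → V) :
    ∑ s : ZMod L, ∑ t : ZMod L, ‖∑ a : ZMod L, ∑ b : ZMod L,
      ZMod.stdAddChar (s * a) • ZMod.stdAddChar (t * b) • y a b‖ ^ 2 =
      (L : ℝ) ^ 2 * ∑ a, ∑ b, ‖y a b‖ ^ 2 := by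
  rw [sum_comm]
  simp_rw [← smul_sum]
  simp_rw [parseval_zmod L]
  rw [← mul_sum, sum_comm]
  simp_rw [parseval_zmod L]
  rw [← mul_sum, ← mul_assoc, sq]

open Finset in
lemma conv_zmod {X : Type*} [AddCommGroup X] [Module ℂ X] (L : ℕ) [NeZero L]
    (p : ℕ → ℕ → ℂ) (d : ℕ) (y : ZMod L → ZMod L → X) (s t : ZMod L) :
    ∑ c : ZMod L, ∑ e : ZMod L, (ZMod.stdAddChar (s * c) : ℂ) • (ZMod.stdAddChar (t * e) : ℂ) •
      (∑ j ∈ range d, ∑ k ∈ range d, p j k • y (c + j) (e + k)) =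
    (∑ j ∈ range d, ∑ k ∈ range d, p j k * (ZMod.stdAddChar (-s) ^ j * ZMod.stdAddChar (-t) ^ k)) •
      ∑ a : ZMod L, ∑ b : ZMod L, (ZMod.stdAddChar (s * a) : ℂ) •
        (ZMod.stdAddChar (t * b) : ℂ) • y a b := by
  simp_rw [smul_sum, sum_smul]
  have h1 : ∀ (s : ZMod L) (c : ZMod L) (j : ℕ), (ZMod.stdAddChar (s * c) : ℂ) =
      ZMod.stdAddChar (-s) ^ j * ZMod.stdAddChar (s * (c + (j : ZMod L))) := by
    intro s c j
    rw [← AddChar.map_nsmul_eq_pow, ← AddChar.map_add_eq_mul]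
    congr 1
    rw [nsmul_eq_mul]
    ring
  calc _ = ∑ c : ZMod L, ∑ e : ZMod L, ∑ j ∈ range d, ∑ k ∈ range d,
        (p j k * (ZMod.stdAddChar (-s) ^ j * ZMod.stdAddChar (-t) ^ k)) •
        (ZMod.stdAddChar (s * (c + (j : ZMod L))) : ℂ) •
          (ZMod.stdAddChar (t * (e + (k : ZMod L))) : ℂ) •
          y (c + j) (e + k) := by
        refine sum_congr rfl fun c _ => sum_congr rfl fun e _ => sum_congr rfl fun j _ =>
          sum_congr rfl fun k _ => ?_
        rw [h1 s c j, h1 t e k]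
        simp only [smul_smul]
        congr 1
        ring
    _ = ∑ j ∈ range d, ∑ k ∈ range d, ∑ c : ZMod L, ∑ e : ZMod L,
        (p j k * (ZMod.stdAddChar (-s) ^ j * ZMod.stdAddChar (-t) ^ k)) •
        (ZMod.stdAddChar (s * (c + (j : ZMod L))) : ℂ) •
          (ZMod.stdAddChar (t * (e + (k : ZMod L))) : ℂ) •
          y (c + j) (e + k) := by
        simp_rw [sum_comm (s := (univ : Finset (ZMod L))) (t := range d)]
    _ = ∑ j ∈ range d, ∑ k ∈ range d, ∑ a : ZMod L, ∑ b : ZMod L,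
        (p j k * (ZMod.stdAddChar (-s) ^ j * ZMod.stdAddChar (-t) ^ k)) •
        (ZMod.stdAddChar (s * a) : ℂ) • (ZMod.stdAddChar (t * b) : ℂ) • y a b := by
        refine sum_congr rfl fun j _ => sum_congr rfl fun k _ => ?_
        symm
        rw [← Equiv.sum_comp (Equiv.addRight (j : ZMod L))]
        refine sum_congr rfl fun c _ => ?_
        rw [← Equiv.sum_comp (Equiv.addRight (k : ZMod L))]
        rfl
    _ = _ := by
        simp_rw [sum_comm (s := range d) (t := (univ : Finset (ZMod L)))]

open Finset in
/-- The von Neumann inequality for two commuting operators that are isometric with respect to an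
increasing sequence of seminorms. -/
lemma von_neumann_of_isometries {X V : Type*} [AddCommGroup X] [Module ℂ X]
    [NormedAddCommGroup V] [InnerProductSpace ℂ V] (W₁ W₂ : Module.End ℂ X)
    (hW : Commute W₁ W₂) (π : ℕ → X →ₗ[ℂ] V) (N : ℕ → X → ℝ)
    (hN : ∀ M x, N M x = ∑ l ∈ range (M + 1), ‖π l x‖ ^ 2)
    (h₁ : ∀ M x, N M (W₁ x) ≤ N M x) (h₁' : ∀ M x, N M x ≤ N (M + 1) (W₁ x))
    (h₂ : ∀ M x, N M (W₂ x) ≤ N M x) (h₂' : ∀ M x, N M x ≤ N (M + 1) (W₂ x))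
    (p : ℕ → ℕ → ℂ) (d : ℕ) {C : ℝ}
    (hC : ∀ ω η : ℂ, ‖ω‖ = 1 → ‖η‖ = 1 →
      ‖∑ j ∈ range d, ∑ k ∈ range d, p j k * (ω ^ j * η ^ k)‖ ≤ C)
    (h : X) {ν : ℝ} (hν : ∀ M, N M h ≤ ν) :
    ‖π 0 (∑ j ∈ range d, ∑ k ∈ range d, p j k • (W₁ ^ j) ((W₂ ^ k) h))‖ ^ 2 ≤ C ^ 2 * ν := by
  set q : X := ∑ j ∈ range d, ∑ k ∈ range d, p j k • (W₁ ^ j) ((W₂ ^ k) h) with hq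
  have hC0 : 0 ≤ C := le_trans (norm_nonneg _) (hC 1 1 (by simp) (by simp))
  have pow_le : ∀ (W : Module.End ℂ X), (∀ M x, N M (W x) ≤ N M x) →
      ∀ n M x, N M ((W ^ n) x) ≤ N M x := by
    intro W hW n
    induction n with
    | zero => intro M x; simp
    | succ n ih =>
      intro M x
      rw [pow_succ, Module.End.mul_apply]
      exact (ih M _).trans (hW M x)
  have le_pow : ∀ (W : Module.End ℂ X), (∀ M x, N M x ≤ N (M + 1) (W x)) →
      ∀ n M x, N M x ≤ N (M + n) ((W ^ n) x) := by
    intro W hW n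
    induction n with
    | zero => intro M x; simp
    | succ n ih =>
      intro M x
      rw [pow_succ, Module.End.mul_apply]
      refine (hW M x).trans ((ih (M + 1) _).trans_eq ?_)
      congr 1
      ring
  have mono : ∀ {M M'} (x), M ≤ M' → N M x ≤ N M' x := by
    intro M M' x hM
    rw [hN, hN]
    exact sum_le_sum_of_subset_of_nonneg (range_mono (by omega)) fun _ _ _ => by positivity
  have main : ∀ n : ℕ, 0 < n → (n : ℝ) ^ 2 * ‖π 0 q‖ ^ 2 ≤ C ^ 2 * (((n + d : ℕ) : ℝ) ^ 2 * ν) := by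
    intro n hn
    set L := n + d with hL
    have : NeZero L := ⟨by omega⟩
    set M := 2 * L with hM
    let y : ZMod L → ZMod L → X := fun a b => (W₁ ^ a.val) ((W₂ ^ b.val) h)
    let Y : ZMod L → ZMod L → X := fun c e =>
      ∑ j ∈ range d, ∑ k ∈ range d, p j k • y (c + j) (e + k)
    have parsN : ∀ y : ZMod L → ZMod L → X, ∑ s : ZMod L, ∑ t : ZMod L,
        N M (∑ a : ZMod L, ∑ b : ZMod L,
          (ZMod.stdAddChar (s * a) : ℂ) • (ZMod.stdAddChar (t * b) : ℂ) • y a b) =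
        (L : ℝ) ^ 2 * ∑ a, ∑ b, N M (y a b) := by
      intro y
      simp_rw [hN, sum_comm (s := (univ : Finset (ZMod L))) (t := range (M + 1)), map_sum,
        map_smul]
      rw [mul_sum]
      refine sum_congr rfl fun l _ => ?_
      exact parseval_zmod_prod L fun a b => π l (y a b)
    have Nsmul : ∀ (c : ℂ) x, N M (c • x) = ‖c‖ ^ 2 * N M x := by
      intro c x
      simp_rw [hN, map_smul, norm_smul, mul_pow, mul_sum]
    have N0 : ∀ x, 0 ≤ N M x := fun x => by rw [hN]; positivity
    have hsum_norm_le : (L : ℝ) ^ 2 * ∑ c, ∑ e, N M (Y c e) ≤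
        C ^ 2 * ((L : ℝ) ^ 2 * ∑ a, ∑ b, N M (y a b)) := by
      rw [← parsN, ← parsN, mul_sum]
      refine sum_le_sum fun s _ => ?_
      rw [mul_sum]
      refine sum_le_sum fun t _ => ?_
      rw [conv_zmod, Nsmul]
      have := hC (ZMod.stdAddChar (-s)) (ZMod.stdAddChar (-t)) (AddChar.norm_apply _ _)
        (AddChar.norm_apply _ _)
      have := N0 (∑ a : ZMod L, ∑ b : ZMod L, (ZMod.stdAddChar (s * a) : ℂ) •
        (ZMod.stdAddChar (t * b) : ℂ) • y a b)
      gcongr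
    have hsum_base_le : ∑ a, ∑ b, N M (y a b) ≤ (L : ℝ) ^ 2 * ν := by
      calc ∑ a, ∑ b, N M (y a b) ≤ ∑ a : ZMod L, ∑ b : ZMod L, ν := by
            refine sum_le_sum fun a _ => sum_le_sum fun b _ => ?_
            exact (pow_le W₁ h₁ _ _ _).trans ((pow_le W₂ h₂ _ _ _).trans (hν M))
        _ = _ := by
            simp only [sum_const, card_univ, ZMod.card, nsmul_eq_mul]; ring
    have hpoly_le : (n : ℝ) ^ 2 * ‖π 0 q‖ ^ 2 ≤ ∑ c, ∑ e, N M (Y c e) := by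
      have hYq : ∀ c < n, ∀ e < n, Y (c : ZMod L) (e : ZMod L) = (W₁ ^ c) ((W₂ ^ e) q) := by
        intro c hc e he
        simp only [Y, y, hq, map_sum, map_smul]
        refine sum_congr rfl fun j hj => sum_congr rfl fun k hk => ?_
        rw [mem_range] at hj hk
        congr 1
        have v : ∀ c < n, ∀ j < d, ((c : ZMod L) + (j : ZMod L)).val = c + j := by
          intro c hc j hj
          rw [← Nat.cast_add, ZMod.val_natCast_of_lt (by omega)]
        rw [v c hc j hj, v e he k hk, pow_add, pow_add, Module.End.mul_apply,
          Module.End.mul_apply]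
        congr 1
        have hc := (hW.pow_pow j e).eq
        have := congrArg (fun T : Module.End ℂ X => T ((W₂ ^ k) h)) hc
        simpa [Module.End.mul_apply] using this
      have hlow : ∀ c < n, ∀ e < n, ‖π 0 q‖ ^ 2 ≤ N M (Y (c : ZMod L) (e : ZMod L)) := by
        intro c hc e he
        rw [hYq c hc e he]
        have h0 : N 0 q = ‖π 0 q‖ ^ 2 := by rw [hN]; simp
        rw [← h0]
        refine (le_pow W₂ h₂' e 0 q).trans ((le_pow W₁ h₁' c _ _).trans (mono _ ?_))
        omega
      have inj : Set.InjOn (fun c : ℕ => (c : ZMod L)) (range n : Set ℕ) := by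
        intro c hc c' hc' hcc
        simp only [coe_range, Set.mem_Iio] at hc hc'
        have := congrArg ZMod.val hcc
        simpa [ZMod.val_natCast_of_lt (show c < L by omega),
          ZMod.val_natCast_of_lt (show c' < L by omega)] using this
      have sub : ∀ g : ZMod L → ℝ, (∀ c, 0 ≤ g c) → ∑ c ∈ range n, g (c : ZMod L) ≤ ∑ c, g c := by
        intro g hg
        rw [← sum_image (s := range n) (g := fun c : ℕ => (c : ZMod L)) (f := g) inj]
        exact sum_le_univ_sum_of_nonneg hg
      calc (n : ℝ) ^ 2 * ‖π 0 q‖ ^ 2 = ∑ c ∈ range n, ∑ e ∈ range n, ‖π 0 q‖ ^ 2 := by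
            simp only [sum_const, card_range, nsmul_eq_mul]; ring
        _ ≤ ∑ c ∈ range n, ∑ e ∈ range n, N M (Y (c : ZMod L) (e : ZMod L)) :=
            sum_le_sum fun c hc => sum_le_sum fun e he =>
              hlow c (mem_range.mp hc) e (mem_range.mp he)
        _ ≤ ∑ c ∈ range n, ∑ e, N M (Y (c : ZMod L) e) :=
            sum_le_sum fun c _ => sub _ fun e => N0 _
        _ ≤ _ := sub (fun c => ∑ e, N M (Y c e)) fun c => sum_nonneg fun e _ => N0 _
    have hLpos : (0 : ℝ) < (L : ℝ) ^ 2 := by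
      have : 0 < L := by omega
      positivity
    have hcontract : ∑ c, ∑ e, N M (Y c e) ≤ C ^ 2 * ∑ a, ∑ b, N M (y a b) := by
      refine le_of_mul_le_mul_left ?_ hLpos
      calc _ ≤ _ := hsum_norm_le
        _ = _ := by ring
    calc _ ≤ _ := hpoly_le
      _ ≤ _ := hcontract
      _ ≤ _ := by gcongr
  have hlim : Filter.Tendsto (fun n : ℕ => C ^ 2 * ((1 + (d : ℝ) * ((n : ℝ) + 1)⁻¹) ^ 2 * ν))
      Filter.atTop (nhds (C ^ 2 * ((1 + (d : ℝ) * 0) ^ 2 * ν))) := by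
    have : Filter.Tendsto (fun n : ℕ => ((n : ℝ) + 1)⁻¹) Filter.atTop (nhds 0) :=
      (Filter.tendsto_atTop_add_const_right _ _ tendsto_natCast_atTop_atTop).inv_tendsto_atTop
    exact ((((this.const_mul _).const_add 1).pow 2).mul_const ν).const_mul _
  have := ge_of_tendsto' hlim (b := ‖π 0 q‖ ^ 2) fun n => by
    have h := main (n + 1) (by omega)
    have hpos : (0 : ℝ) < ((n : ℝ) + 1) ^ 2 := by positivity
    push_cast at h
    refine le_of_mul_le_mul_left (h.trans_eq ?_) hpos
    field_simp
  simpa using this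

/-- A square array of complex numbers is positive semidefinite. -/
def PSDArray {ι : Type*} [Fintype ι] (K : ι → ι → ℂ) : Prop :=
  ∀ c : ι → ℂ, 0 ≤ ∑ i, ∑ j, (starRingEnd ℂ) (c i) * c j * K i j

open scoped MatrixOrder in
lemma PSDArray.exists_gram {ι : Type*} [Fintype ι] {K : ι → ι → ℂ} (hK : PSDArray K) :
    ∃ b : ι → EuclideanSpace ℂ ι, ∀ i j, K i j = inner ℂ (b j) (b i) := by
  classical
  have hq : ∀ c : ι → ℂ, star c ⬝ᵥ (Matrix.of K).mulVec c =
      ∑ i, ∑ j, (starRingEnd ℂ) (c i) * c j * K i j := by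
    intro c
    simp only [dotProduct, Matrix.mulVec, Finset.mul_sum, Pi.star_apply, Matrix.of_apply]
    refine Finset.sum_congr rfl fun i _ => Finset.sum_congr rfl fun j _ => ?_
    rw [starRingEnd_apply]; ring
  have hP : (Matrix.of K).PosSemidef := by
    rw [← Matrix.isPositive_toEuclideanLin_iff, LinearMap.isPositive_iff_complex]
    intro x
    have h1 : inner ℂ ((Matrix.of K).toEuclideanLin x) x =
        (starRingEnd ℂ) (∑ i, ∑ j, (starRingEnd ℂ) (x i) * x j * K i j) := by
      rw [← inner_conj_symm, ← hq, EuclideanSpace.inner_eq_star_dotProduct, dotProduct_comm]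
      rfl
    obtain ⟨h2, h3⟩ := Complex.nonneg_iff.mp (hK x)
    rw [h1]
    refine ⟨?_, by rw [RCLike.conj_re]; exact h2⟩
    apply Complex.ext
    · simp
    · simp only [Complex.conj_im, ← h3]; simp
  obtain ⟨B, hB⟩ := CStarAlgebra.nonneg_iff_eq_star_mul_self.mp hP.nonneg
  refine ⟨fun i => WithLp.toLp 2 fun k => (starRingEnd ℂ) (B k i), fun i j => ?_⟩
  have := congrFun (congrFun hB i) j
  simp only [Matrix.of_apply] at this
  rw [this, Matrix.mul_apply]
  simp [PiLp.inner_apply, mul_comm, Matrix.star_apply]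

lemma sum_inner_eq_norm_sq {ι V : Type*} [Fintype ι] [NormedAddCommGroup V]
    [InnerProductSpace ℂ V] (b : ι → V) (c : ι → ℂ) :
    ∑ i, ∑ j, (starRingEnd ℂ) (c i) * c j * inner ℂ (b j) (b i) =
      ((‖∑ i, (starRingEnd ℂ) (c i) • b i‖ ^ 2 : ℝ) : ℂ) := by
  have e : ∀ v : V, ((‖v‖ ^ 2 : ℝ) : ℂ) = inner ℂ v v := fun v => by
    rw [inner_self_eq_norm_sq_to_K]; push_cast; rfl
  rw [e, sum_inner, Finset.sum_comm]
  refine Finset.sum_congr rfl fun j _ => ?_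
  rw [inner_sum]
  refine Finset.sum_congr rfl fun i _ => ?_
  rw [inner_smul_left, inner_smul_right, Complex.conj_conj]
  ring

lemma psdArray_inner {ι V : Type*} [Fintype ι] [NormedAddCommGroup V]
    [InnerProductSpace ℂ V] (b : ι → V) : PSDArray fun i j => inner ℂ (b j) (b i) := by
  intro c
  rw [sum_inner_eq_norm_sq]
  exact_mod_cast sq_nonneg (‖∑ i, (starRingEnd ℂ) (c i) • b i‖)

lemma exists_linearIsometryEquiv_of_norm_eq {X F : Type*} [AddCommGroup X] [Module ℂ X]
    [NormedAddCommGroup F] [InnerProductSpace ℂ F] [FiniteDimensional ℂ F]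
    (α β : X →ₗ[ℂ] F) (h : ∀ c, ‖α c‖ = ‖β c‖) :
    ∃ G : F ≃ₗᵢ[ℂ] F, ∀ c, G (α c) = β c := by
  have hker : ∀ c d, α c = α d → β c = β d := by
    intro c d hcd
    rw [← sub_eq_zero, ← map_sub, ← norm_eq_zero, ← h, map_sub, hcd, sub_self, norm_zero]
  choose g hg using fun y : LinearMap.range α => y.2
  let L : LinearMap.range α →ₗᵢ[ℂ] F :=
    { toFun := fun y => β (g y)
      map_add' := fun x y => by
        rw [← map_add]
        apply hker
        rw [map_add, hg, hg, hg]; rfl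
      map_smul' := fun a x => by
        rw [RingHom.id_apply, ← map_smul]
        apply hker
        rw [map_smul, hg, hg]; rfl
      norm_map' := fun x => by
        change ‖β (g x)‖ = ‖x‖
        rw [← h, hg]; rfl }
  refine ⟨L.extend.toLinearIsometryEquiv rfl, fun c => ?_⟩
  have := L.extend_apply ⟨α c, c, rfl⟩
  rw [LinearIsometry.coe_toLinearIsometryEquiv]
  rw [this]
  exact hker _ _ (hg ⟨α c, c, rfl⟩)

lemma exists_linearEquiv_prod_of_norm_eq {X E : Type*} [AddCommGroup X] [Module ℂ X]
    [NormedAddCommGroup E] [InnerProductSpace ℂ E] [FiniteDimensional ℂ E]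
    (α β : X →ₗ[ℂ] E × E)
    (h : ∀ c, ‖(α c).1‖ ^ 2 + ‖(α c).2‖ ^ 2 = ‖(β c).1‖ ^ 2 + ‖(β c).2‖ ^ 2) :
    ∃ G : (E × E) ≃ₗ[ℂ] (E × E), (∀ c, G (α c) = β c) ∧
      ∀ x, ‖(G x).1‖ ^ 2 + ‖(G x).2‖ ^ 2 = ‖x.1‖ ^ 2 + ‖x.2‖ ^ 2 := by
  let e := WithLp.linearEquiv 2 ℂ (E × E)
  obtain ⟨G, hG⟩ := exists_linearIsometryEquiv_of_norm_eq
    (e.symm.toLinearMap ∘ₗ α) (e.symm.toLinearMap ∘ₗ β) (by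
      intro c
      rw [← sq_eq_sq₀ (norm_nonneg _) (norm_nonneg _), WithLp.prod_norm_sq_eq_of_L2,
        WithLp.prod_norm_sq_eq_of_L2]
      exact h c)
  refine ⟨e.symm.trans (G.toLinearEquiv.trans e), fun c => ?_, fun x => ?_⟩
  · exact congrArg e (hG c)
  · have := G.norm_map (e.symm x)
    rw [← sq_eq_sq₀ (norm_nonneg _) (norm_nonneg _), WithLp.prod_norm_sq_eq_of_L2,
        WithLp.prod_norm_sq_eq_of_L2] at this
    exact this

/-- The von Neumann inequality for a pair of commuting contractions (Andô's theorem). -/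
lemma von_neumann_of_contractions {X E : Type*} [AddCommGroup X] [Module ℂ X]
    [NormedAddCommGroup E] [InnerProductSpace ℂ E] [FiniteDimensional ℂ E]
    (T₁ T₂ : Module.End ℂ X) (hT : ∀ c, T₁ (T₂ c) = T₂ (T₁ c)) (κ α β : X →ₗ[ℂ] E)
    (h₁ : ∀ c, ‖κ c‖ ^ 2 = ‖κ (T₁ c)‖ ^ 2 + ‖α c‖ ^ 2)
    (h₂ : ∀ c, ‖κ c‖ ^ 2 = ‖κ (T₂ c)‖ ^ 2 + ‖β c‖ ^ 2)
    (p : ℕ → ℕ → ℂ) (d : ℕ) {C : ℝ}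
    (hC : ∀ ω η : ℂ, ‖ω‖ = 1 → ‖η‖ = 1 →
      ‖∑ j ∈ Finset.range d, ∑ k ∈ Finset.range d, p j k * (ω ^ j * η ^ k)‖ ≤ C) (c : X) :
    ‖κ (∑ j ∈ Finset.range d, ∑ k ∈ Finset.range d, p j k • (T₁ ^ j) ((T₂ ^ k) c))‖ ^ 2 ≤
      C ^ 2 * ‖κ c‖ ^ 2 := by
  obtain ⟨G, hG, hGn⟩ := exists_linearEquiv_prod_of_norm_eq
    (LinearMap.prod (α ∘ₗ T₂) β) (LinearMap.prod (β ∘ₗ T₁) α) (by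
      intro c
      have e1 := h₁ c
      have e2 := h₂ c
      have e3 := h₁ (T₂ c)
      have e4 := h₂ (T₁ c)
      rw [hT] at e3
      simp only [LinearMap.prod_apply, Function.prod_apply, LinearMap.comp_apply]
      linarith)
  have hGn' : ∀ x, ‖x.1‖ ^ 2 + ‖x.2‖ ^ 2 = ‖(G.symm x).1‖ ^ 2 + ‖(G.symm x).2‖ ^ 2 := fun x => by
    rw [← hGn (G.symm x), G.apply_symm_apply]
  let Y := X × (ℕ → E × E)
  let crd : ℕ → Y →ₗ[ℂ] E × E := fun m => LinearMap.proj m ∘ₗ LinearMap.snd ℂ X (ℕ → E × E)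
  let sh₁ : ℕ → Y →ₗ[ℂ] E := fun m => Nat.casesOn m (α ∘ₗ LinearMap.fst ℂ X (ℕ → E × E))
    fun m => LinearMap.snd ℂ E E ∘ₗ crd m
  let sh₂ : ℕ → Y →ₗ[ℂ] E := fun m => Nat.casesOn m (β ∘ₗ LinearMap.fst ℂ X (ℕ → E × E))
    fun m => LinearMap.snd ℂ E E ∘ₗ G.symm.toLinearMap ∘ₗ crd m
  let W₁ : Module.End ℂ Y := LinearMap.prod (T₁ ∘ₗ LinearMap.fst ℂ X (ℕ → E × E))
    (LinearMap.pi fun m => G.toLinearMap ∘ₗ LinearMap.prod (sh₁ m) (LinearMap.fst ℂ E E ∘ₗ crd m))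
  let W₂ : Module.End ℂ Y := LinearMap.prod (T₂ ∘ₗ LinearMap.fst ℂ X (ℕ → E × E))
    (LinearMap.pi fun m => LinearMap.prod (sh₂ m)
      (LinearMap.fst ℂ E E ∘ₗ G.symm.toLinearMap ∘ₗ crd m))
  have W₁0 : ∀ x : Y, (W₁ x).2 0 = G (α x.1, (x.2 0).1) := fun x => rfl
  have W₁s : ∀ (x : Y) m, (W₁ x).2 (m + 1) = G ((x.2 m).2, (x.2 (m + 1)).1) := fun x m => rfl
  have W₂0 : ∀ x : Y, (W₂ x).2 0 = (β x.1, (G.symm (x.2 0)).1) := fun x => rfl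
  have W₂s : ∀ (x : Y) m, (W₂ x).2 (m + 1) =
    ((G.symm (x.2 m)).2, (G.symm (x.2 (m + 1))).1) := fun x m => rfl
  have W₁f : ∀ x : Y, (W₁ x).1 = T₁ x.1 := fun x => rfl
  have W₂f : ∀ x : Y, (W₂ x).1 = T₂ x.1 := fun x => rfl
  have hG' : ∀ c, G (α (T₂ c), β c) = (β (T₁ c), α c) := hG
  have hW : Commute W₁ W₂ := by
    refine LinearMap.ext fun x => Prod.ext (hT x.1) (funext fun m => ?_)
    rw [Module.End.mul_apply, Module.End.mul_apply]
    cases m with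
    | zero => rw [W₁0, W₂0, W₂0, W₁0, W₂f, W₁f, hG', G.symm_apply_apply]
    | succ m =>
      cases m with
      | zero => rw [W₁s, W₂s, W₂s, W₁s, W₁0, W₂0]; simp
      | succ m => rw [W₁s, W₂s, W₂s, W₂s, W₁s, W₁s]; simp
  let e := (WithLp.linearEquiv 2 ℂ (E × E)).symm.toLinearMap
  let π : ℕ → Y →ₗ[ℂ] WithLp 2 (E × E) := fun m => Nat.casesOn m
    (e ∘ₗ LinearMap.prod (κ ∘ₗ LinearMap.fst ℂ X (ℕ → E × E)) 0) fun m => e ∘ₗ crd m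
  have π0 : ∀ x, ‖π 0 x‖ ^ 2 = ‖κ x.1‖ ^ 2 := fun x => by
    rw [WithLp.prod_norm_sq_eq_of_L2]
    change ‖κ x.1‖ ^ 2 + ‖(0 : E)‖ ^ 2 = _
    simp
  have πs : ∀ m x, ‖π (m + 1) x‖ ^ 2 = ‖(x.2 m).1‖ ^ 2 + ‖(x.2 m).2‖ ^ 2 := fun m x => by
    rw [WithLp.prod_norm_sq_eq_of_L2]
    rfl
  let N : ℕ → Y → ℝ := fun M x => ∑ l ∈ Finset.range (M + 1), ‖π l x‖ ^ 2
  have N0 : ∀ x, N 0 x = ‖κ x.1‖ ^ 2 := fun x => by simp [N, π0]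
  have Ns : ∀ M x, N (M + 1) x = N M x + (‖(x.2 M).1‖ ^ 2 + ‖(x.2 M).2‖ ^ 2) := fun M x => by
    simp only [N]
    rw [Finset.sum_range_succ, πs]
  have k₁ : ∀ M x, N (M + 1) (W₁ x) = N M x + ‖(x.2 M).1‖ ^ 2 := by
    intro M x
    induction M with
    | zero => rw [Ns, N0, N0, W₁0, hGn, W₁f, h₁ x.1]; ring
    | succ M ih => rw [Ns, ih, Ns, W₁s, hGn]; ring
  have k₂ : ∀ M x, N (M + 1) (W₂ x) = N M x + ‖(G.symm (x.2 M)).1‖ ^ 2 := by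
    intro M x
    induction M with
    | zero => rw [Ns, N0, N0, W₂0, W₂f, h₂ x.1]; ring
    | succ M ih => rw [Ns, ih, Ns M x, W₂s, hGn' (x.2 M)]; ring
  have main := von_neumann_of_isometries W₁ W₂ hW π N (fun M x => rfl)
    (by
      intro M x
      cases M with
      | zero => rw [N0, N0, W₁f, h₁ x.1]; linarith [sq_nonneg ‖α x.1‖]
      | succ M => rw [k₁, Ns]; linarith [sq_nonneg ‖(x.2 M).2‖])
    (by intro M x; rw [k₁]; linarith [sq_nonneg ‖(x.2 M).1‖])
    (by
      intro M x
      cases M with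
      | zero => rw [N0, N0, W₂f, h₂ x.1]; linarith [sq_nonneg ‖β x.1‖]
      | succ M => rw [k₂, Ns, hGn']; linarith [sq_nonneg ‖(G.symm (x.2 M)).2‖])
    (by intro M x; rw [k₂]; linarith [sq_nonneg ‖(G.symm (x.2 M)).1‖])
    p d hC (c, 0) (ν := ‖κ c‖ ^ 2) (by
      intro M
      induction M with
      | zero => rw [N0]
      | succ M ih => rw [Ns]; simpa using ih)
  rw [π0] at main
  have p₁ : ∀ n (x : Y), ((W₁ ^ n) x).1 = (T₁ ^ n) x.1 := by
    intro n
    induction n with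
    | zero => intro x; rfl
    | succ n ih => intro x; rw [pow_succ, pow_succ, Module.End.mul_apply, ih]; rfl
  have p₂ : ∀ n (x : Y), ((W₂ ^ n) x).1 = (T₂ ^ n) x.1 := by
    intro n
    induction n with
    | zero => intro x; rfl
    | succ n ih => intro x; rw [pow_succ, pow_succ, Module.End.mul_apply, ih]; rfl
  have key : LinearMap.fst ℂ X (ℕ → E × E) (∑ j ∈ Finset.range d, ∑ k ∈ Finset.range d,
      p j k • (W₁ ^ j) ((W₂ ^ k) (c, 0))) =
      ∑ j ∈ Finset.range d, ∑ k ∈ Finset.range d, p j k • (T₁ ^ j) ((T₂ ^ k) c) := by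
    rw [map_sum]
    refine Finset.sum_congr rfl fun j _ => ?_
    rw [map_sum]
    refine Finset.sum_congr rfl fun k _ => ?_
    rw [map_smul, LinearMap.fst_apply, p₁, p₂]
  rw [← key]
  exact main

lemma sum_mul_conj_inner {ι V : Type*} [Fintype ι] [NormedAddCommGroup V]
    [InnerProductSpace ℂ V] (b : ι → V) (c : ι → ℂ) :
    ∑ i, ∑ j, c i * (starRingEnd ℂ) (c j) * inner ℂ (b j) (b i) =
      ((‖∑ i, c i • b i‖ ^ 2 : ℝ) : ℂ) := by
  simpa using sum_inner_eq_norm_sq b fun i => (starRingEnd ℂ) (c i)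

lemma PSDArray.of_tendsto {ι τ : Type*} [Fintype ι] {l : Filter τ} [l.NeBot]
    {A : τ → ι → ι → ℂ} {K : ι → ι → ℂ} (hA : ∀ᶠ t in l, PSDArray (A t))
    (h : ∀ i j, Tendsto (fun t => A t i j) l (𝓝 (K i j))) : PSDArray K := by
  intro c
  refine ge_of_tendsto (f := fun t => ∑ i, ∑ j, (starRingEnd ℂ) (c i) * c j * A t i j) (x := l)
    ?_ (hA.mono fun t ht => ht c)
  exact tendsto_finsetSum _ fun i _ => tendsto_finsetSum _ fun j _ => (h i j).const_mul _

open Finset in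
lemma PSDArray.of_polynomial {ι : Type*} [Fintype ι] (x : ι → ℂ × ℂ) {K : ι → ι → ℂ}
    (hK : PSDArray K)
    (hK₁ : PSDArray fun i j => (1 - (x i).1 * (starRingEnd ℂ) (x j).1) * K i j)
    (hK₂ : PSDArray fun i j => (1 - (x i).2 * (starRingEnd ℂ) (x j).2) * K i j)
    (p : ℕ → ℕ → ℂ) (d : ℕ) {C : ℝ}
    (hC : ∀ ω η : ℂ, ‖ω‖ = 1 → ‖η‖ = 1 →
      ‖∑ j ∈ range d, ∑ k ∈ range d, p j k * (ω ^ j * η ^ k)‖ ≤ C) :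
    PSDArray fun i i' => ((C : ℂ) ^ 2 -
      (∑ j ∈ range d, ∑ k ∈ range d, p j k * ((x i).1 ^ j * (x i).2 ^ k)) *
      (starRingEnd ℂ) (∑ j ∈ range d, ∑ k ∈ range d, p j k * ((x i').1 ^ j * (x i').2 ^ k))) *
      K i i' := by
  obtain ⟨k, hk⟩ := hK.exists_gram
  obtain ⟨a, ha⟩ := hK₁.exists_gram
  obtain ⟨b, hb⟩ := hK₂.exists_gram
  let syn : (ι → EuclideanSpace ℂ ι) → ((ι → ℂ) →ₗ[ℂ] EuclideanSpace ℂ ι) :=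
    fun v => Fintype.linearCombination ℂ v
  have hsyn : ∀ v c, syn v c = ∑ i, c i • v i := fun v c => Fintype.linearCombination_apply ℂ v c
  let T : (ι → ℂ) → Module.End ℂ (ι → ℂ) := fun u => LinearMap.mulLeft ℂ u
  have hT : ∀ u c i, T u c i = u i * c i := fun u c i => rfl
  have contr : ∀ (u : ι → ℂ) (v : ι → EuclideanSpace ℂ ι),
      (∀ i j, (1 - u i * (starRingEnd ℂ) (u j)) * K i j = inner ℂ (v j) (v i)) →
      ∀ c, ‖syn k c‖ ^ 2 = ‖syn k (T u c)‖ ^ 2 + ‖syn v c‖ ^ 2 := by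
    intro u v hv c
    have : (((‖syn k c‖ ^ 2 : ℝ)) : ℂ) = ((‖syn k (T u c)‖ ^ 2 + ‖syn v c‖ ^ 2 : ℝ) : ℂ) := by
      rw [Complex.ofReal_add]
      simp only [hsyn, hT]
      rw [← sum_mul_conj_inner, ← sum_mul_conj_inner, ← sum_mul_conj_inner, ← sum_add_distrib]
      refine sum_congr rfl fun i _ => ?_
      rw [← sum_add_distrib]
      refine sum_congr rfl fun j _ => ?_
      rw [← hv, ← hk, map_mul]
      ring
    exact_mod_cast this
  have main := von_neumann_of_contractions (T fun i => (x i).1) (T fun i => (x i).2)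
    (fun c => funext fun i => by simp only [hT]; ring) (syn k) (syn a) (syn b)
    (contr _ a ha) (contr _ b hb) p d hC
  have hpow : ∀ u n c i, (T u ^ n) c i = u i ^ n * c i := by
    intro u n
    induction n with
    | zero => intro c i; simp
    | succ n ih => intro c i; rw [pow_succ, Module.End.mul_apply, ih, hT]; ring
  set P : ι → ℂ := fun i => ∑ j ∈ range d, ∑ k ∈ range d, p j k * ((x i).1 ^ j * (x i).2 ^ k)
    with hP
  have hPT : ∀ c : ι → ℂ, (∑ j ∈ range d, ∑ k ∈ range d, p j k •
      (T (fun i => (x i).1) ^ j) ((T (fun i => (x i).2) ^ k) c)) = fun i => P i * c i := by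
    intro c
    funext i
    simp only [Finset.sum_apply, Pi.smul_apply, hpow, hP, sum_mul, smul_eq_mul]
    refine sum_congr rfl fun _ _ => sum_congr rfl fun _ _ => ?_
    ring
  intro c
  have h := main fun i => (starRingEnd ℂ) (c i)
  rw [hPT, hsyn, hsyn] at h
  have h2 : ∑ i, ∑ j, (starRingEnd ℂ) (c i) * c j *
      (((C : ℂ) ^ 2 - P i * (starRingEnd ℂ) (P j)) * K i j) =
      ((C ^ 2 * ‖∑ i, (starRingEnd ℂ) (c i) • k i‖ ^ 2 -
        ‖∑ i, (P i * (starRingEnd ℂ) (c i)) • k i‖ ^ 2 : ℝ) : ℂ) := by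
    rw [Complex.ofReal_sub, Complex.ofReal_mul, ← sum_mul_conj_inner, ← sum_mul_conj_inner,
      mul_sum, ← sum_sub_distrib]
    refine sum_congr rfl fun i _ => ?_
    rw [mul_sum, ← sum_sub_distrib]
    refine sum_congr rfl fun j _ => ?_
    rw [← hk, map_mul, Complex.conj_conj]
    push_cast
    ring
  rw [h2]
  exact Complex.zero_le_real.mpr (sub_nonneg.mpr h)

open Finset in
/-- The von Neumann inequality for bounded holomorphic functions on the bidisc. -/
lemma PSDArray.of_bounded_holomorphic {ι : Type*} [Fintype ι] {x : ι → ℂ × ℂ}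
    (hx : ∀ i, x i ∈ biDisc) {K : ι → ι → ℂ} (hK : PSDArray K)
    (hK₁ : PSDArray fun i j => (1 - (x i).1 * (starRingEnd ℂ) (x j).1) * K i j)
    (hK₂ : PSDArray fun i j => (1 - (x i).2 * (starRingEnd ℂ) (x j).2) * K i j)
    {f : ℂ × ℂ → ℂ} {B : ℝ} (hf : DifferentiableOn ℂ f biDisc) (hB : ∀ z ∈ biDisc, ‖f z‖ ≤ B) :
    PSDArray fun i j => ((B : ℂ) ^ 2 - f (x i) * (starRingEnd ℂ) (f (x j))) * K i j := by
  obtain ⟨a, ha, hsum⟩ := exists_taylor_biDisc hf hB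
  have hopen : IsOpen biDisc := by rw [biDisc_eq_ball]; exact Metric.isOpen_ball
  have hfin : Tendsto (fun d => range d ×ˢ range d) atTop (atTop : Filter (Finset (ℕ × ℕ))) := by
    refine tendsto_atTop_finset_of_monotone ?_ ?_
    · intro m n hmn
      exact product_subset_product (range_mono hmn) (range_mono hmn)
    · rintro ⟨i, j⟩
      refine ⟨max i j + 1, ?_⟩
      simp only [mem_product, mem_range]
      omega
  have scaled : ∀ ρ : ℝ, 0 ≤ ρ → ρ < 1 → PSDArray fun i j =>
      ((B : ℂ) ^ 2 - f ((ρ : ℂ) • x i) * (starRingEnd ℂ) (f ((ρ : ℂ) • x j))) * K i j := by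
    intro ρ h0 h1
    have hmem : ∀ z : ℂ × ℂ, ‖z.1‖ ≤ 1 → ‖z.2‖ ≤ 1 → (ρ : ℂ) • z ∈ biDisc := by
      intro z hz hz'
      refine ⟨?_, ?_⟩
      · rw [Prod.smul_fst, norm_smul, Complex.norm_real, Real.norm_of_nonneg h0]; nlinarith
      · rw [Prod.smul_snd, norm_smul, Complex.norm_real, Real.norm_of_nonneg h0]; nlinarith
    let p : ℕ → ℕ → ℂ := fun j k => a (j, k) * ((ρ : ℂ) ^ j * (ρ : ℂ) ^ k)
    have hg : Summable fun q : ℕ × ℕ => B * (ρ ^ q.1 * ρ ^ q.2) := by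
      have := summable_biDisc_geometric (B := B) (hmem (1, 1) (by simp) (by simp))
      simpa [abs_of_nonneg h0] using this
    set S := ∑' q : ℕ × ℕ, B * (ρ ^ q.1 * ρ ^ q.2)
    let C : ℕ → ℝ := fun d => B + (S - ∑ q ∈ range d ×ˢ range d, B * (ρ ^ q.1 * ρ ^ q.2))
    have hCt : Tendsto C atTop (𝓝 B) := by
      have h : Tendsto C atTop (𝓝 (B + (S - S))) := ((hg.hasSum.comp hfin).const_sub S).const_add B
      rwa [sub_self, add_zero] at h
    have hpeq : ∀ d (z : ℂ × ℂ), ∑ j ∈ range d, ∑ k ∈ range d, p j k * (z.1 ^ j * z.2 ^ k) =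
        ∑ q ∈ range d ×ˢ range d,
          a q * ((((ρ : ℂ) • z).1) ^ q.1 * (((ρ : ℂ) • z).2) ^ q.2) := by
      intro d z
      rw [sum_product]
      refine sum_congr rfl fun j _ => sum_congr rfl fun k _ => ?_
      simp only [p, Prod.smul_fst, Prod.smul_snd, smul_eq_mul, mul_pow]
      ring
    have hC : ∀ d (ω η : ℂ), ‖ω‖ = 1 → ‖η‖ = 1 →
        ‖∑ j ∈ range d, ∑ k ∈ range d, p j k * (ω ^ j * η ^ k)‖ ≤ C d := by
      intro d ω η hω hη
      have hm := hmem (ω, η) hω.le hη.le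
      rw [hpeq d (ω, η)]
      set F : ℕ × ℕ → ℂ := fun q =>
        a q * ((((ρ : ℂ) • (ω, η)).1) ^ q.1 * (((ρ : ℂ) • (ω, η)).2) ^ q.2)
      set s := range d ×ˢ range d
      have t1 : HasSum (fun q : {q // q ∉ s} => F q) (f ((ρ : ℂ) • (ω, η)) - ∑ q ∈ s, F q) := by
        rw [Finset.hasSum_compl_iff, sub_add_cancel]
        exact hsum _ hm
      have t2 : HasSum (fun q : {q // q ∉ s} => B * (ρ ^ q.1.1 * ρ ^ q.1.2))
          (S - ∑ q ∈ s, B * (ρ ^ q.1 * ρ ^ q.2)) := by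
        rw [Finset.hasSum_compl_iff (f := fun q : ℕ × ℕ => B * (ρ ^ q.1 * ρ ^ q.2))]
        simpa using hg.hasSum
      have t3 := HasSum.norm_le_of_bounded t1 t2 (by
        rintro ⟨q, hq⟩
        simp only [F, Prod.smul_mk, smul_eq_mul, mul_pow, norm_mul, norm_pow, hω, hη,
          Complex.norm_real, Real.norm_of_nonneg h0, one_pow, mul_one]
        exact mul_le_mul_of_nonneg_right (ha q) (by positivity))
      have t4 := hB _ hm
      have t5 : ∑ q ∈ s, F q = f ((ρ : ℂ) • (ω, η)) - (f ((ρ : ℂ) • (ω, η)) - ∑ q ∈ s, F q) := by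
        ring
      rw [t5]
      exact (norm_sub_le _ _).trans (add_le_add t4 t3)
    refine PSDArray.of_tendsto (l := atTop) (Eventually.of_forall fun d =>
      PSDArray.of_polynomial x hK hK₁ hK₂ p d (hC d)) fun i j => ?_
    have hP : ∀ i, Tendsto (fun d => ∑ j ∈ range d, ∑ k ∈ range d,
        p j k * ((x i).1 ^ j * (x i).2 ^ k)) atTop (𝓝 (f ((ρ : ℂ) • x i))) := by
      intro i
      simp_rw [hpeq]
      exact (hsum _ (hmem _ (hx i).1.le (hx i).2.le)).comp hfin
    have hC' : Tendsto (fun d => (C d : ℂ)) atTop (𝓝 (B : ℂ)) :=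
      (Complex.continuous_ofReal.tendsto B).comp hCt
    exact ((hC'.pow 2).sub ((hP i).mul
      ((Complex.continuous_conj.tendsto _).comp (hP j)))).mul_const _
  have hlim : ∀ i, Tendsto (fun ρ : ℝ => f ((ρ : ℂ) • x i)) (𝓝[<] 1) (𝓝 (f (x i))) := by
    intro i
    have h1 : Tendsto (fun ρ : ℝ => (ρ : ℂ) • x i) (𝓝[<] 1) (𝓝 (x i)) := by
      have : Continuous fun ρ : ℝ => (ρ : ℂ) • x i := by fun_prop
      have h2 := this.tendsto 1
      simp only [Complex.ofReal_one, one_smul] at h2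
      exact h2.mono_left nhdsWithin_le_nhds
    exact ((hf.differentiableAt (hopen.mem_nhds (hx i))).continuousAt.tendsto).comp h1
  refine PSDArray.of_tendsto (l := 𝓝[<] (1 : ℝ)) (A := fun ρ i j =>
    ((B : ℂ) ^ 2 - f ((ρ : ℂ) • x i) * (starRingEnd ℂ) (f ((ρ : ℂ) • x j))) * K i j) ?_ ?_
  · filter_upwards [Ioo_mem_nhdsLT (show (0 : ℝ) < 1 by norm_num)] with ρ hρ
    exact scaled ρ hρ.1.le hρ.2
  · intro i j
    exact (((hlim i).mul
      ((Complex.continuous_conj.tendsto _).comp (hlim j))).const_sub _).mul_const _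

lemma PSDKernelOn.psdArray {X ι : Type*} [Fintype ι] {S : Set X} {k : X → X → ℂ}
    (hk : PSDKernelOn S k) {x : ι → X} (hx : ∀ i, x i ∈ S) :
    PSDArray fun i j => k (x i) (x j) := by
  intro c
  let e := Fintype.equivFin ι
  have h := hk _ (fun a => x (e.symm a)) (fun a => hx _) fun a => c (e.symm a)
  rw [Equiv.sum_comp e.symm fun i => ∑ a, (starRingEnd ℂ) (c i) * c (e.symm a) *
    k (x i) (x (e.symm a))] at h
  refine h.trans_eq (Finset.sum_congr rfl fun i _ => ?_)
  exact Equiv.sum_comp e.symm fun j => (starRingEnd ℂ) (c i) * c j * k (x i) (x j)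

lemma PSDArray.rescale {ι : Type*} [Fintype ι] {K : ι → ι → ℂ} (hK : PSDArray K) (d : ι → ℂ) :
    PSDArray fun i j => d i * (starRingEnd ℂ) (d j) * K i j := by
  intro c
  have := hK fun i => (starRingEnd ℂ) (d i) * c i
  refine this.trans_eq (Finset.sum_congr rfl fun i _ => Finset.sum_congr rfl fun j _ => ?_)
  simp only [map_mul, Complex.conj_conj]
  ring

lemma Admissible2.gram2_eq {Λ : ℕ → ℂ × ℂ} {k : ℂ × ℂ → ℂ × ℂ → ℂ} (hk : Admissible2 Λ k)
    (i j : ℕ) : Gram2 Λ k i j = ((√(k (Λ i) (Λ i)).re)⁻¹ : ℝ) *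
      (starRingEnd ℂ) ((√(k (Λ j) (Λ j)).re)⁻¹ : ℝ) * k (Λ i) (Λ j) := by
  have h0 := (Complex.pos_iff.mp (hk.2.2.2 i)).1
  rw [Gram2, Real.sqrt_mul h0.le, Complex.conj_ofReal]
  push_cast
  rw [div_eq_mul_inv, mul_inv]
  ring

lemma Admissible2.gram2_self {Λ : ℕ → ℂ × ℂ} {k : ℂ × ℂ → ℂ × ℂ → ℂ} (hk : Admissible2 Λ k)
    (i : ℕ) : Gram2 Λ k i i = 1 := by
  have h0 := Complex.pos_iff.mp (hk.2.2.2 i)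
  rw [Gram2, Real.sqrt_mul_self h0.1.le, ← Complex.ofReal_one]
  have : k (Λ i) (Λ i) = ((k (Λ i) (Λ i)).re : ℂ) := Complex.ext rfl (by simp [← h0.2])
  rw [this, Complex.ofReal_re, ← Complex.ofReal_div, div_self h0.1.ne']

lemma Admissible2.psdArray_gram2 {Λ : ℕ → ℂ × ℂ} (hΛ : ∀ i, Λ i ∈ biDisc)
    {k : ℂ × ℂ → ℂ × ℂ → ℂ} (hk : Admissible2 Λ k) {ι : Type*} [Fintype ι] (σ : ι → ℕ) :
    PSDArray (fun i j => Gram2 Λ k (σ i) (σ j)) ∧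
    PSDArray (fun i j => (1 - (Λ (σ i)).1 * (starRingEnd ℂ) (Λ (σ j)).1) *
      Gram2 Λ k (σ i) (σ j)) ∧
    PSDArray (fun i j => (1 - (Λ (σ i)).2 * (starRingEnd ℂ) (Λ (σ j)).2) *
      Gram2 Λ k (σ i) (σ j)) := by
  let d : ι → ℂ := fun i => ((√(k (Λ (σ i)) (Λ (σ i))).re)⁻¹ : ℝ)
  refine ⟨?_, ?_, ?_⟩
  · convert (hk.1.psdArray fun i => hΛ (σ i)).rescale d using 3 with i j
    exact hk.gram2_eq _ _
  · convert (hk.2.1.psdArray fun i => hΛ (σ i)).rescale d using 3 with i j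
    rw [hk.gram2_eq]; ring
  · convert (hk.2.2.1.psdArray fun i => hΛ (σ i)).rescale d using 3 with i j
    rw [hk.gram2_eq]; ring

lemma exists_signs_sum_le {ι V : Type*} [NormedAddCommGroup V] [InnerProductSpace ℂ V]
    (v : ι → V) (s : Finset ι) : ∃ ε : ι → ℝ, (∀ i, ε i = 1 ∨ ε i = -1) ∧
      ‖∑ i ∈ s, (ε i : ℂ) • v i‖ ^ 2 ≤ ∑ i ∈ s, ‖v i‖ ^ 2 := by
  classical
  induction s using Finset.induction_on with
  | empty => exact ⟨fun _ => 1, fun _ => Or.inl rfl, by simp⟩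
  | insert a s ha ih =>
    obtain ⟨ε, hε, h⟩ := ih
    have key : ∀ δ : ℝ, ∑ i ∈ insert a s, ((Function.update ε a δ i : ℝ) : ℂ) • v i =
        (δ : ℂ) • v a + ∑ i ∈ s, (ε i : ℂ) • v i := by
      intro δ
      rw [Finset.sum_insert ha, Function.update_self]
      congr 1
      refine Finset.sum_congr rfl fun i hi => ?_
      rw [Function.update_of_ne (ne_of_mem_of_not_mem hi ha)]
    have hsign : ∀ δ : ℝ, (δ = 1 ∨ δ = -1) → ∀ i, Function.update ε a δ i = 1 ∨
        Function.update ε a δ i = -1 := by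
      intro δ hδ i
      rcases eq_or_ne i a with rfl | hi
      · simpa using hδ
      · simpa [Function.update_of_ne hi] using hε i
    have par := parallelogram_law_with_norm ℂ (∑ i ∈ s, (ε i : ℂ) • v i) (v a)
    rw [Finset.sum_insert ha]
    by_cases hc : ‖v a + ∑ i ∈ s, (ε i : ℂ) • v i‖ ^ 2 ≤ ‖v a‖ ^ 2 + ∑ i ∈ s, ‖v i‖ ^ 2
    · exact ⟨_, hsign 1 (Or.inl rfl), by rw [key]; simpa using hc⟩
    · refine ⟨_, hsign (-1) (Or.inr rfl), ?_⟩
      rw [key]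
      push_cast
      rw [neg_one_smul, neg_add_eq_sub]
      rw [add_comm (v a)] at hc
      nlinarith

lemma exists_signs_le_sum {ι V : Type*} [NormedAddCommGroup V] [InnerProductSpace ℂ V]
    (v : ι → V) (s : Finset ι) : ∃ ε : ι → ℝ, (∀ i, ε i = 1 ∨ ε i = -1) ∧
      ∑ i ∈ s, ‖v i‖ ^ 2 ≤ ‖∑ i ∈ s, (ε i : ℂ) • v i‖ ^ 2 := by
  classical
  induction s using Finset.induction_on with
  | empty => exact ⟨fun _ => 1, fun _ => Or.inl rfl, by simp⟩
  | insert a s ha ih =>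
    obtain ⟨ε, hε, h⟩ := ih
    have key : ∀ δ : ℝ, ∑ i ∈ insert a s, ((Function.update ε a δ i : ℝ) : ℂ) • v i =
        (δ : ℂ) • v a + ∑ i ∈ s, (ε i : ℂ) • v i := by
      intro δ
      rw [Finset.sum_insert ha, Function.update_self]
      congr 1
      refine Finset.sum_congr rfl fun i hi => ?_
      rw [Function.update_of_ne (ne_of_mem_of_not_mem hi ha)]
    have hsign : ∀ δ : ℝ, (δ = 1 ∨ δ = -1) → ∀ i, Function.update ε a δ i = 1 ∨
        Function.update ε a δ i = -1 := by
      intro δ hδ i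
      rcases eq_or_ne i a with rfl | hi
      · simpa using hδ
      · simpa [Function.update_of_ne hi] using hε i
    have par := parallelogram_law_with_norm ℂ (∑ i ∈ s, (ε i : ℂ) • v i) (v a)
    rw [Finset.sum_insert ha]
    by_cases hc : ‖v a‖ ^ 2 + ∑ i ∈ s, ‖v i‖ ^ 2 ≤ ‖v a + ∑ i ∈ s, (ε i : ℂ) • v i‖ ^ 2
    · exact ⟨_, hsign 1 (Or.inl rfl), by rw [key]; simpa using hc⟩
    · refine ⟨_, hsign (-1) (Or.inr rfl), ?_⟩
      rw [key]
      push_cast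
      rw [neg_one_smul, neg_add_eq_sub]
      rw [add_comm (v a)] at hc
      nlinarith

lemma exists_uniform_sign_interpolation {Λ : ℕ → ℂ × ℂ} (hΛ : ∀ i, Λ i ∈ biDisc)
    (h : ∀ w : ℕ → ℂ, BddAbove (Set.range fun i => ‖w i‖) →
        ∃ f : ℂ × ℂ → ℂ, DifferentiableOn ℂ f biDisc ∧
          (∃ B : ℝ, ∀ z ∈ biDisc, ‖f z‖ ≤ B) ∧ ∀ i, f (Λ i) = w i) :
    ∃ M : ℝ, 0 < M ∧ ∀ ε : ℕ → ℝ, (∀ i, ε i = 1 ∨ ε i = -1) → ∃ f : ℂ × ℂ → ℂ,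
      DifferentiableOn ℂ f biDisc ∧ (∀ z ∈ biDisc, ‖f z‖ ≤ M) ∧ ∀ i, f (Λ i) = ε i := by
  classical
  let sg : Bool → ℂ := fun b => cond b 1 (-1)
  have hsg : ∀ b, ‖sg b‖ = 1 := by intro b; cases b <;> simp [sg]
  let E : ℕ → Set (ℕ → Bool) := fun m => {ε | ∃ f : ℂ × ℂ → ℂ,
    DifferentiableOn ℂ f biDisc ∧ (∀ z ∈ biDisc, ‖f z‖ ≤ m) ∧ ∀ i, f (Λ i) = sg (ε i)}
  have hclosed : ∀ m, IsClosed (E m) := by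
    intro m
    rw [isClosed_iff_ultrafilter]
    intro x u hu hE
    choose! f hf using fun (ε : ℕ → Bool) (hε : ε ∈ E m) => hε
    obtain ⟨g, hg, hgB, hgt⟩ := montel_biDisc u (f := fun ε => if ε ∈ E m then f ε else 0) (B := m)
      (by
        intro ε
        by_cases hε : ε ∈ E m
        · simpa [hε] using (hf ε hε).1
        · simp only [hε, if_false]; exact differentiableOn_const 0)
      (by
        intro ε z hz
        by_cases hε : ε ∈ E m
        · simpa [hε] using (hf ε hε).2.1 z hz
        · simp [hε])
    refine ⟨g, hg, hgB, fun i => tendsto_nhds_unique (hgt _ (hΛ i)) ?_⟩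
    refine tendsto_const_nhds.congr' ?_
    have hi : ∀ᶠ ε in (u : Filter (ℕ → Bool)), ε i = x i := by
      have : ∀ᶠ ε in 𝓝 x, ε i = x i :=
        ((continuous_apply i).tendsto x) (by simp [nhds_discrete] : {b | b = x i} ∈ 𝓝 (x i))
      exact hu this
    filter_upwards [hi, hE] with ε h1 h2
    simp only [h2, if_true]
    rw [(hf ε h2).2.2 i, h1]
  have hU : ⋃ m, E m = Set.univ := by
    refine Set.eq_univ_of_forall fun ε => Set.mem_iUnion.mpr ?_
    obtain ⟨f, hf, ⟨B, hB⟩, hi⟩ := h (fun i => sg (ε i)) ⟨1, by rintro _ ⟨i, rfl⟩; exact (hsg _).le⟩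
    obtain ⟨m, hm⟩ := exists_nat_ge B
    exact ⟨m, f, hf, fun z hz => (hB z hz).trans hm, hi⟩
  obtain ⟨m, ε₀, hε₀⟩ := nonempty_interior_of_iUnion_of_closed hclosed hU
  obtain ⟨I, u, hu, hsub⟩ := isOpen_pi_iff.mp isOpen_interior ε₀ hε₀
  choose δ hδ hδB hδi using fun n : ℕ => h (Pi.single n 1) ⟨1, by
    rintro _ ⟨i, rfl⟩
    rcases eq_or_ne i n with rfl | hi
    · simp
    · simp [hi]⟩
  choose D hD using hδB
  have hz0 : (0 : ℂ × ℂ) ∈ biDisc := by simp [biDisc]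
  have hD0 : ∀ n, 0 ≤ D n := fun n => (norm_nonneg _).trans (hD n 0 hz0)
  refine ⟨m + ∑ i ∈ I, 2 * D i + 1, ?_, fun ε hε => ?_⟩
  · have : 0 ≤ ∑ i ∈ I, 2 * D i := Finset.sum_nonneg fun i _ => by linarith [hD0 i]
    positivity
  let b : ℕ → Bool := fun i => decide (ε i = 1)
  have hb : ∀ i, sg (b i) = ε i := by
    intro i
    rcases hε i with hi | hi
    · simp [b, sg, hi]
    · have : ¬ ((-1 : ℝ) = 1) := by norm_num
      simp [b, sg, hi, this]
  have hmem : (fun i => if i ∈ I then ε₀ i else b i) ∈ E m := by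
    refine interior_subset (hsub fun i hi => ?_)
    have hi' : i ∈ I := hi
    simpa [hi'] using (hu i hi').2
  obtain ⟨f, hf, hfB, hfi⟩ := hmem
  refine ⟨fun z => f z + ∑ i ∈ I, (sg (b i) - sg (ε₀ i)) * δ i z, ?_, ?_, ?_⟩
  · exact hf.fun_add (DifferentiableOn.fun_sum fun i _ => (hδ i).const_mul _)
  · intro z hz
    have h1 : ‖∑ i ∈ I, (sg (b i) - sg (ε₀ i)) * δ i z‖ ≤ ∑ i ∈ I, 2 * D i := by
      refine norm_sum_le_of_le _ fun i _ => ?_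
      rw [norm_mul]
      refine mul_le_mul ?_ (hD i z hz) (norm_nonneg _) (by norm_num)
      have := norm_sub_le (sg (b i)) (sg (ε₀ i))
      rw [hsg, hsg] at this
      linarith
    have := norm_add_le (f z) (∑ i ∈ I, (sg (b i) - sg (ε₀ i)) * δ i z)
    linarith [hfB z hz]
  · intro n
    simp only [hfi, hδi]
    by_cases hn : n ∈ I
    · simp [Pi.single_apply, hn, hb]
    · simp [Pi.single_apply, hn, hb]

lemma gram2_bounds {Λ : ℕ → ℂ × ℂ} (hΛ : ∀ i, Λ i ∈ biDisc) {M : ℝ} (hM : 0 < M)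
    (h : ∀ ε : ℕ → ℝ, (∀ i, ε i = 1 ∨ ε i = -1) → ∃ f : ℂ × ℂ → ℂ,
      DifferentiableOn ℂ f biDisc ∧ (∀ z ∈ biDisc, ‖f z‖ ≤ M) ∧ ∀ i, f (Λ i) = ε i)
    {k : ℂ × ℂ → ℂ × ℂ → ℂ} (hk : Admissible2 Λ k) (s : Finset ℕ) (α : ℕ → ℂ) :
    ((((M ^ 2)⁻¹ * ∑ i ∈ s, ‖α i‖ ^ 2 : ℝ)) : ℂ) ≤
      ∑ i ∈ s, ∑ j ∈ s, (starRingEnd ℂ) (α i) * α j * Gram2 Λ k i j ∧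
    ∑ i ∈ s, ∑ j ∈ s, (starRingEnd ℂ) (α i) * α j * Gram2 Λ k i j ≤
      (((M ^ 2 * ∑ i ∈ s, ‖α i‖ ^ 2 : ℝ)) : ℂ) := by
  obtain ⟨h0, h1, h2⟩ := hk.psdArray_gram2 hΛ fun i : s => (i : ℕ)
  obtain ⟨g, hg⟩ := h0.exists_gram
  have hg1 : ∀ i, ‖g i‖ = 1 := by
    intro i
    have := hg i i
    rw [hk.gram2_self, inner_self_eq_norm_sq_to_K] at this
    have h3 : (1 : ℝ) = ‖g i‖ ^ 2 := Complex.ofReal_injective (by push_cast; exact this)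
    nlinarith [norm_nonneg (g i)]
  have hsum : ∀ c : ℕ → ℂ, ∑ i ∈ s, ∑ j ∈ s, (starRingEnd ℂ) (c i) * c j * Gram2 Λ k i j =
      ((‖∑ i : s, (starRingEnd ℂ) (c i) • g i‖ ^ 2 : ℝ) : ℂ) := by
    intro c
    rw [← sum_inner_eq_norm_sq g fun i : s => c i]
    simp_rw [← hg]
    rw [← Finset.sum_coe_sort s]
    refine Finset.sum_congr rfl fun i _ => ?_
    rw [← Finset.sum_coe_sort s]
  have hcontr : ∀ ε : s → ℝ, (∀ i, ε i = 1 ∨ ε i = -1) → ∀ c : s → ℂ,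
      ‖∑ i, (ε i : ℂ) • c i • g i‖ ^ 2 ≤ M ^ 2 * ‖∑ i, c i • g i‖ ^ 2 := by
    intro ε hε c
    obtain ⟨f, hf, hfM, hfi⟩ := h (fun i => if hi : i ∈ s then ε ⟨i, hi⟩ else 1) (by
      intro i
      by_cases hi : i ∈ s
      · simpa [hi] using hε ⟨i, hi⟩
      · simp [hi])
    have hfi' : ∀ i : s, f (Λ i) = ε i := fun i => by rw [hfi]; simp
    have h3 := PSDArray.of_bounded_holomorphic (fun i : s => hΛ i) h0 h1 h2 hf hfM
      fun i => (starRingEnd ℂ) (c i)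
    have h4 : ∑ i, ∑ j, (starRingEnd ℂ) ((starRingEnd ℂ) (c i)) * (starRingEnd ℂ) (c j) *
        (((M : ℂ) ^ 2 - f (Λ i) * (starRingEnd ℂ) (f (Λ j))) * Gram2 Λ k i j) =
        ((M ^ 2 * ‖∑ i, c i • g i‖ ^ 2 - ‖∑ i, ((ε i : ℂ) * c i) • g i‖ ^ 2 : ℝ) : ℂ) := by
      rw [Complex.ofReal_sub, Complex.ofReal_mul, ← sum_mul_conj_inner, ← sum_mul_conj_inner,
        Finset.mul_sum, ← Finset.sum_sub_distrib]
      refine Finset.sum_congr rfl fun i _ => ?_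
      rw [Finset.mul_sum, ← Finset.sum_sub_distrib]
      refine Finset.sum_congr rfl fun j _ => ?_
      rw [← hg, hfi', hfi', map_mul, Complex.conj_conj]
      push_cast
      ring
    rw [h4] at h3
    simpa only [mul_smul] using sub_nonneg.mp (Complex.zero_le_real.mp h3)
  have hnorm : ∑ i : s, ‖(starRingEnd ℂ) (α i) • g i‖ ^ 2 = ∑ i ∈ s, ‖α i‖ ^ 2 := by
    rw [← Finset.sum_coe_sort s]
    refine Finset.sum_congr rfl fun i _ => ?_
    rw [norm_smul, hg1, mul_one, RCLike.norm_conj]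
  rw [hsum, Complex.real_le_real, Complex.real_le_real]
  constructor
  · obtain ⟨ε, hε, hle⟩ := exists_signs_le_sum (fun i : s => (starRingEnd ℂ) (α i) • g i)
      Finset.univ
    rw [hnorm] at hle
    rw [inv_mul_le_iff₀ (by positivity)]
    exact hle.trans (hcontr ε hε _)
  · obtain ⟨ε, hε, hle⟩ := exists_signs_sum_le (fun i : s => (starRingEnd ℂ) (α i) • g i)
      Finset.univ
    rw [hnorm] at hle
    have h5 := hcontr ε hε fun i => (ε i : ℂ) * (starRingEnd ℂ) (α i)
    have h6 : ∀ i, (ε i : ℂ) * (ε i : ℂ) = 1 := by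
      intro i
      rcases hε i with hi | hi <;> simp [hi]
    simp only [smul_smul, ← mul_assoc, h6, one_mul] at h5
    simp only [smul_smul] at hle
    exact h5.trans (mul_le_mul_of_nonneg_left hle (by positivity))

lemma strongly_separated_of_signs {Λ : ℕ → ℂ × ℂ} {M : ℝ}
    (h : ∀ ε : ℕ → ℝ, (∀ i, ε i = 1 ∨ ε i = -1) → ∃ f : ℂ × ℂ → ℂ,
      DifferentiableOn ℂ f biDisc ∧ (∀ z ∈ biDisc, ‖f z‖ ≤ M) ∧ ∀ i, f (Λ i) = ε i) :
    ∃ φ : ℕ → ℂ × ℂ → ℂ, ∀ i,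
      DifferentiableOn ℂ (φ i) biDisc ∧ (∀ z ∈ biDisc, ‖φ i z‖ ≤ M) ∧
      φ i (Λ i) = 1 ∧ ∀ n, n ≠ i → φ i (Λ n) = 0 := by
  choose f hf hfM hfi using h
  have h1 : ∀ i : ℕ, (1 : ℝ) = 1 ∨ (1 : ℝ) = -1 := fun _ => Or.inl rfl
  have h2 : ∀ m i : ℕ, (if i = m then (1 : ℝ) else -1) = 1 ∨
      (if i = m then (1 : ℝ) else -1) = -1 := fun m i => by
    by_cases hi : i = m <;> simp [hi]
  refine ⟨fun m z => (f (fun _ => 1) h1 z + f _ (h2 m) z) / 2, fun m => ⟨?_, ?_, ?_, ?_⟩⟩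
  · simp only [div_eq_mul_inv]
    exact ((hf _ h1).fun_add (hf _ (h2 m))).mul_const _
  · intro z hz
    have := norm_add_le (f (fun _ => 1) h1 z) (f _ (h2 m) z)
    rw [norm_div]
    norm_num
    linarith [hfM _ h1 z hz, hfM _ (h2 m) z hz]
  · simp [hfi]
  · intro n hn
    simp [hfi, hn]

lemma PSDArray.add {ι : Type*} [Fintype ι] {A B : ι → ι → ℂ} (hA : PSDArray A)
    (hB : PSDArray B) : PSDArray fun i j => A i j + B i j := by
  intro c
  refine (add_nonneg (hA c) (hB c)).trans_eq ?_
  simp only [← Finset.sum_add_distrib, mul_add]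

lemma PSDArray.smul {ι : Type*} [Fintype ι] {A : ι → ι → ℂ} (hA : PSDArray A) {t : ℝ}
    (ht : 0 ≤ t) : PSDArray fun i j => (t : ℂ) * A i j := by
  intro c
  refine (mul_nonneg (Complex.zero_le_real.mpr ht) (hA c)).trans_eq ?_
  simp only [Finset.mul_sum]
  refine Finset.sum_congr rfl fun i _ => Finset.sum_congr rfl fun j _ => ?_
  ring

lemma psdArray_mul_conj {ι : Type*} [Fintype ι] (d : ι → ℂ) :
    PSDArray fun i j => d i * (starRingEnd ℂ) (d j) := by
  convert psdArray_inner d using 3 with i j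
  rw [RCLike.inner_apply]

lemma PSDArray.of_one_sub_mul {ι : Type*} [Fintype ι] {u : ι → ℂ} (hu : ∀ i, ‖u i‖ < 1)
    {K : ι → ι → ℂ} (h : PSDArray fun i j => (1 - u i * (starRingEnd ℂ) (u j)) * K i j) :
    PSDArray K := by
  have hn : ∀ n : ℕ, PSDArray fun i j => K i j -
      (u i * (starRingEnd ℂ) (u j)) ^ n * K i j := by
    intro n
    induction n with
    | zero => intro c; simp
    | succ n ih =>
      convert ih.add (h.rescale fun i => u i ^ n) using 3 with i j
      simp only [map_pow]
      ring
  refine PSDArray.of_tendsto (l := atTop) (Eventually.of_forall hn) fun i j => ?_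
  have : Tendsto (fun n : ℕ => (u i * (starRingEnd ℂ) (u j)) ^ n) atTop (𝓝 0) := by
    refine tendsto_pow_atTop_nhds_zero_of_norm_lt_one ?_
    rw [norm_mul, RCLike.norm_conj]
    exact mul_lt_one_of_nonneg_of_lt_one_left (norm_nonneg _) (hu i) (hu j).le
  simpa using (this.mul_const (K i j)).const_sub (K i j)

lemma PSDArray.diag_nonneg {ι : Type*} [Fintype ι] {K : ι → ι → ℂ} (hK : PSDArray K) (i : ι) :
    0 ≤ (K i i).re := by
  obtain ⟨b, hb⟩ := hK.exists_gram
  rw [hb, inner_self_eq_norm_sq_to_K]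
  exact_mod_cast sq_nonneg ‖b i‖

lemma PSDArray.norm_le {ι : Type*} [Fintype ι] {K : ι → ι → ℂ} (hK : PSDArray K) {R : ℝ}
    (hR : ∀ i, (K i i).re ≤ R) (i j : ι) : ‖K i j‖ ≤ R := by
  obtain ⟨b, hb⟩ := hK.exists_gram
  have h : ∀ i, ‖b i‖ ^ 2 ≤ R := by
    intro i
    have := hR i
    rw [hb, inner_self_eq_norm_sq_to_K] at this
    exact_mod_cast this
  rw [hb]
  nlinarith [norm_inner_le_norm (𝕜 := ℂ) (b j) (b i), h i, h j, sq_nonneg (‖b i‖ - ‖b j‖)]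

/-- The cone of arrays admitting an Agler decomposition at the points `x i`. -/
def aglerCone {ι : Type*} [Fintype ι] (x : ι → ℂ × ℂ) : Set (ι → ι → ℂ) :=
  {X | ∃ Γ Δ : ι → ι → ℂ, PSDArray Γ ∧ PSDArray Δ ∧ ∀ i j, X i j =
    (1 - (x i).1 * (starRingEnd ℂ) (x j).1) * Γ i j +
    (1 - (x i).2 * (starRingEnd ℂ) (x j).2) * Δ i j}

lemma isClosed_aglerCone {ι : Type*} [Fintype ι] {x : ι → ℂ × ℂ} (hx : ∀ i, x i ∈ biDisc) :
    IsClosed (aglerCone x) := by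
  classical
  rw [isClosed_iff_ultrafilter]
  intro X u hu hX
  choose! Γ Δ hΓ hΔ hΓΔ using fun (Y : ι → ι → ℂ) (hY : Y ∈ aglerCone x) => hY
  have hbd : ∀ᶠ Y in (u : Filter (ι → ι → ℂ)), ‖Y‖ < ‖X‖ + 1 :=
    hu ((continuous_norm.tendsto X).eventually_lt_const (lt_add_one _))
  have diag : ∀ (v : ℂ), (1 - v * (starRingEnd ℂ) v) = ((1 - ‖v‖ ^ 2 : ℝ) : ℂ) := by
    intro v; rw [Complex.mul_conj, Complex.normSq_eq_norm_sq]; push_cast; rfl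
  have pos₁ : ∀ i, 0 < 1 - ‖(x i).1‖ ^ 2 := fun i => by
    nlinarith [(hx i).1, norm_nonneg (x i).1]
  have pos₂ : ∀ i, 0 < 1 - ‖(x i).2‖ ^ 2 := fun i => by
    nlinarith [(hx i).2, norm_nonneg (x i).2]
  let R₁ := ∑ i, (‖X‖ + 1) / (1 - ‖(x i).1‖ ^ 2)
  let R₂ := ∑ i, (‖X‖ + 1) / (1 - ‖(x i).2‖ ^ 2)
  have hmain : ∀ Y ∈ aglerCone x, ‖Y‖ < ‖X‖ + 1 →
      (∀ i j, ‖Γ Y i j‖ ≤ R₁) ∧ ∀ i j, ‖Δ Y i j‖ ≤ R₂ := by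
    intro Y hY hYX
    have hdiag : ∀ i, (1 - ‖(x i).1‖ ^ 2) * (Γ Y i i).re +
        (1 - ‖(x i).2‖ ^ 2) * (Δ Y i i).re ≤ ‖X‖ + 1 := by
      intro i
      have h1 := congrArg Complex.re (hΓΔ Y hY i i)
      rw [diag, diag, Complex.add_re, Complex.re_ofReal_mul, Complex.re_ofReal_mul] at h1
      rw [← h1]
      exact ((Complex.re_le_norm _).trans
        ((norm_le_pi_norm (Y i) i).trans (norm_le_pi_norm Y i))).trans hYX.le
    have n₁ := fun i => (hΓ Y hY).diag_nonneg i
    have n₂ := fun i => (hΔ Y hY).diag_nonneg i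
    constructor
    · refine (hΓ Y hY).norm_le fun i => ?_
      have : (Γ Y i i).re ≤ (‖X‖ + 1) / (1 - ‖(x i).1‖ ^ 2) := by
        rw [le_div_iff₀ (pos₁ i)]
        nlinarith [hdiag i, mul_nonneg (pos₂ i).le (n₂ i)]
      refine this.trans (Finset.single_le_sum
        (f := fun i => (‖X‖ + 1) / (1 - ‖(x i).1‖ ^ 2)) (fun i _ => ?_) (Finset.mem_univ i))
      exact div_nonneg (by positivity) (pos₁ i).le
    · refine (hΔ Y hY).norm_le fun i => ?_
      have : (Δ Y i i).re ≤ (‖X‖ + 1) / (1 - ‖(x i).2‖ ^ 2) := by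
        rw [le_div_iff₀ (pos₂ i)]
        nlinarith [hdiag i, mul_nonneg (pos₁ i).le (n₁ i)]
      refine this.trans (Finset.single_le_sum
        (f := fun i => (‖X‖ + 1) / (1 - ‖(x i).2‖ ^ 2)) (fun i _ => ?_) (Finset.mem_univ i))
      exact div_nonneg (by positivity) (pos₂ i).le
  have hlim : ∀ (Θ : (ι → ι → ℂ) → ι → ι → ℂ) (R : ℝ),
      (∀ᶠ Y in (u : Filter (ι → ι → ℂ)), ∀ i j, ‖Θ Y i j‖ ≤ R) →
      ∃ T, Tendsto Θ u (𝓝 T) := by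
    intro Θ R hR
    have hcpt : IsCompact (Set.univ.pi fun _ : ι => Set.univ.pi fun _ : ι =>
        Metric.closedBall (0 : ℂ) R) :=
      isCompact_univ_pi fun _ => isCompact_univ_pi fun _ => isCompact_closedBall _ _
    obtain ⟨T, -, hT⟩ := hcpt.ultrafilter_le_nhds (u.map Θ) (by
      rw [le_principal_iff]
      refine mem_map.mpr (hR.mono fun Y hY => ?_)
      simpa [Set.mem_pi] using hY)
    exact ⟨T, hT⟩
  obtain ⟨T₁, hT₁⟩ := hlim Γ R₁ (by filter_upwards [hX, hbd] with Y h1 h2 using (hmain Y h1 h2).1)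
  obtain ⟨T₂, hT₂⟩ := hlim Δ R₂ (by filter_upwards [hX, hbd] with Y h1 h2 using (hmain Y h1 h2).2)
  have c₁ : ∀ i j, Tendsto (fun Y => Γ Y i j) u (𝓝 (T₁ i j)) := fun i j =>
    tendsto_pi_nhds.mp (tendsto_pi_nhds.mp hT₁ i) j
  have c₂ : ∀ i j, Tendsto (fun Y => Δ Y i j) u (𝓝 (T₂ i j)) := fun i j =>
    tendsto_pi_nhds.mp (tendsto_pi_nhds.mp hT₂ i) j
  refine ⟨T₁, T₂, PSDArray.of_tendsto (l := (u : Filter (ι → ι → ℂ))) ?_ c₁,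
    PSDArray.of_tendsto (l := (u : Filter (ι → ι → ℂ))) ?_ c₂, fun i j => ?_⟩
  · filter_upwards [hX] with Y hY using hΓ Y hY
  · filter_upwards [hX] with Y hY using hΔ Y hY
  · have hX' : Tendsto (fun Y : ι → ι → ℂ => Y i j) u (𝓝 (X i j)) :=
      tendsto_pi_nhds.mp (tendsto_pi_nhds.mp (show Tendsto id u (𝓝 X) from hu) i) j
    refine tendsto_nhds_unique hX' ((((c₁ i j).const_mul _).add ((c₂ i j).const_mul _)).congr' ?_)
    filter_upwards [hX] with Y hY using (hΓΔ Y hY i j).symm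

/-- An Hermitian array which is nonnegative against all positive kernels for which the coordinate
functions are contractive multipliers has an Agler decomposition. -/
lemma mem_aglerCone_of_forall_nonneg {ι : Type*} [Fintype ι] {x : ι → ℂ × ℂ}
    (hx : ∀ i, x i ∈ biDisc) {J : ι → ι → ℂ} (hJ : ∀ i j, J j i = (starRingEnd ℂ) (J i j))
    (h : ∀ K : ι → ι → ℂ, PSDArray K →
      (PSDArray fun i j => (1 - (x i).1 * (starRingEnd ℂ) (x j).1) * K i j) →
      (PSDArray fun i j => (1 - (x i).2 * (starRingEnd ℂ) (x j).2) * K i j) →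
      0 ≤ (∑ i, ∑ j, J i j * K i j).re) : J ∈ aglerCone x := by
  classical
  by_contra hJC
  have hconv : Convex ℝ (aglerCone x) := by
    rintro X ⟨Γ, Δ, hΓ, hΔ, hX⟩ Y ⟨Γ', Δ', hΓ', hΔ', hY⟩ s t hs ht -
    refine ⟨_, _, (hΓ.smul hs).add (hΓ'.smul ht), (hΔ.smul hs).add (hΔ'.smul ht), fun i j => ?_⟩
    simp only [Pi.add_apply, Pi.smul_apply, Complex.real_smul, hX, hY]
    ring
  obtain ⟨f, r, hf, hfJ⟩ := geometric_hahn_banach_closed_point hconv (isClosed_aglerCone hx) hJC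
  have hzero : (0 : ι → ι → ℂ) ∈ aglerCone x :=
    ⟨0, 0, fun c => by simp, fun c => by simp, fun i j => by simp⟩
  have hr : 0 < r := by simpa using hf 0 hzero
  have hneg : ∀ X ∈ aglerCone x, f X ≤ 0 := by
    intro X hX
    by_contra hpos
    push Not at hpos
    obtain ⟨Γ, Δ, hΓ, hΔ, hX⟩ := hX
    have := hf ((r / f X) • X) ⟨_, _, hΓ.smul (div_pos hr hpos).le, hΔ.smul (div_pos hr hpos).le,
      fun i j => by
        simp only [Pi.smul_apply, Complex.real_smul, hX]
        ring⟩
    rw [map_smul, smul_eq_mul, div_mul_cancel₀ _ hpos.ne'] at this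
    exact lt_irrefl _ this
  let e : ι → ι → ℂ → ι → ι → ℂ := fun i j v => Pi.single i (Pi.single j v)
  let L : ι → ι → ℂ := fun i j => -((f (e i j 1) : ℝ) : ℂ) + (f (e i j Complex.I) : ℝ) * Complex.I
  have hL : ∀ X : ι → ι → ℂ, -f X = (∑ i, ∑ j, X i j * L i j).re := by
    intro X
    have hX : X = ∑ i, ∑ j, ((X i j).re • e i j 1 + (X i j).im • e i j Complex.I) := by
      funext a b
      have he : ∀ i j v, e i j v a b = if a = i then if b = j then v else 0 else 0 := by
        intro i j v
        by_cases hi : a = i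
        · subst hi; simp [e, Pi.single_apply]
        · simp [e, hi]
      simp only [Finset.sum_apply, Pi.add_apply, Pi.smul_apply, he, Complex.real_smul]
      rw [Finset.sum_eq_single a (fun i _ hi => by simp [hi.symm]) (by simp),
        Finset.sum_eq_single b (fun j _ hj => by simp [hj.symm]) (by simp)]
      simp [Complex.re_add_im]
    conv_lhs => rw [hX]
    simp only [map_sum, map_add, map_smul, Complex.re_sum, ← Finset.sum_neg_distrib]
    refine Finset.sum_congr rfl fun i _ => Finset.sum_congr rfl fun j _ => ?_
    simp [L]
    ring
  let K : ι → ι → ℂ := fun i j => (L i j + (starRingEnd ℂ) (L j i)) / 2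
  have hKX : ∀ X : ι → ι → ℂ, (∀ i j, X j i = (starRingEnd ℂ) (X i j)) →
      (∑ i, ∑ j, X i j * K i j).re = -f X := by
    intro X hX
    have h1 : (∑ i, ∑ j, X i j * (starRingEnd ℂ) (L j i)) =
        (starRingEnd ℂ) (∑ i, ∑ j, X i j * L i j) := by
      rw [map_sum, Finset.sum_comm]
      refine Finset.sum_congr rfl fun i _ => ?_
      rw [map_sum]
      refine Finset.sum_congr rfl fun j _ => ?_
      rw [map_mul, hX i j]
    have h2 : (∑ i, ∑ j, X i j * K i j) = ((∑ i, ∑ j, X i j * L i j) +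
        (starRingEnd ℂ) (∑ i, ∑ j, X i j * L i j)) / 2 := by
      rw [← h1, ← Finset.sum_add_distrib, Finset.sum_div]
      refine Finset.sum_congr rfl fun i _ => ?_
      rw [← Finset.sum_add_distrib, Finset.sum_div]
      refine Finset.sum_congr rfl fun j _ => ?_
      simp only [K]
      ring
    rw [h2, hL, Complex.add_conj]
    simp
  have hKherm : ∀ i j, K j i = (starRingEnd ℂ) (K i j) := by
    intro i j
    simp only [K, map_div₀, map_add, Complex.conj_conj, map_ofNat]
    ring
  have hform : ∀ v : ι → ℂ,
      (∀ d : ι → ℂ, (fun i j => (1 - v i * (starRingEnd ℂ) (v j)) *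
        (d i * (starRingEnd ℂ) (d j))) ∈ aglerCone x) →
      PSDArray fun i j => (1 - v i * (starRingEnd ℂ) (v j)) * K i j := by
    intro v hv c
    set S := ∑ i, ∑ j, (starRingEnd ℂ) (c i) * c j *
      ((1 - v i * (starRingEnd ℂ) (v j)) * K i j) with hS
    have h1 := hneg _ (hv fun i => (starRingEnd ℂ) (c i))
    rw [← neg_nonneg, ← hKX _ (by intro i j; simp; ring)] at h1
    have h2 : S = ∑ i, ∑ j, ((1 - v i * (starRingEnd ℂ) (v j)) *
        ((starRingEnd ℂ) (c i) * (starRingEnd ℂ) ((starRingEnd ℂ) (c j)))) * K i j := by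
      refine Finset.sum_congr rfl fun i _ => Finset.sum_congr rfl fun j _ => ?_
      rw [Complex.conj_conj]; ring
    rw [← h2] at h1
    have h3 : (starRingEnd ℂ) S = S := by
      rw [hS, map_sum, Finset.sum_comm]
      refine Finset.sum_congr rfl fun i _ => ?_
      rw [map_sum]
      refine Finset.sum_congr rfl fun j _ => ?_
      simp only [map_mul, map_sub, map_one, Complex.conj_conj, ← hKherm]
      ring
    exact Complex.nonneg_iff.mpr ⟨h1, (Complex.conj_eq_iff_im.mp h3).symm⟩
  have hK₁ := hform (fun i => (x i).1) fun d =>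
    ⟨_, 0, psdArray_mul_conj d, fun c => by simp, fun i j => by simp⟩
  have hK₂ := hform (fun i => (x i).2) fun d =>
    ⟨0, _, fun c => by simp, psdArray_mul_conj d, fun i j => by simp⟩
  have := h K (PSDArray.of_one_sub_mul (fun i => (hx i).1) hK₁) hK₁ hK₂
  rw [hKX J hJ] at this
  linarith

lemma PSDKernelOn.add {X : Type*} {S : Set X} {k l : X → X → ℂ} (hk : PSDKernelOn S k)
    (hl : PSDKernelOn S l) : PSDKernelOn S fun z w => k z w + l z w := by
  intro n x hx c
  refine (add_nonneg (hk n x hx c) (hl n x hx c)).trans_eq ?_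
  simp only [← Finset.sum_add_distrib, mul_add]

lemma psdKernelOn_of_array {X ι : Type*} [Fintype ι] {S : Set X} (χ : ι → X → ℝ)
    {A : ι → ι → ℂ} (hA : PSDArray A) :
    PSDKernelOn S fun z w => ∑ i, ∑ j, (χ i z : ℂ) * χ j w * A i j := by
  obtain ⟨b, hb⟩ := hA.exists_gram
  intro n x hx
  have : ∀ a a', ∑ i, ∑ j, (χ i (x a) : ℂ) * χ j (x a') * A i j =
      inner ℂ (∑ j, (χ j (x a') : ℂ) • b j) (∑ i, (χ i (x a) : ℂ) • b i) := by
    intro a a'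
    rw [sum_inner, Finset.sum_comm]
    refine Finset.sum_congr rfl fun j _ => ?_
    rw [inner_sum]
    refine Finset.sum_congr rfl fun i _ => ?_
    rw [inner_smul_left, inner_smul_right, Complex.conj_ofReal, hb]
    ring
  simp_rw [this]
  exact psdArray_inner fun a => ∑ i, (χ i (x a) : ℂ) • b i

lemma psdKernelOn_diagonal {X : Type*} [DecidableEq X] {S : Set X} {h : X → ℝ} (hh : ∀ z ∈ S, 0 ≤ h z) :
    PSDKernelOn S fun z w => if z = w then (h z : ℂ) else 0 := by
  intro n x hx
  classical
  let v : Fin n → EuclideanSpace ℂ (Set.range x) := fun a =>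
    (√(h (x a)) : ℂ) • EuclideanSpace.single ⟨x a, a, rfl⟩ 1
  have : ∀ a b, (if x a = x b then (h (x a) : ℂ) else 0) = inner ℂ (v b) (v a) := by
    intro a b
    simp only [v, inner_smul_left, inner_smul_right, EuclideanSpace.inner_single_left]
    by_cases hab : x a = x b
    · have := Real.mul_self_sqrt (hh _ (hx b))
      simp [hab, ← Complex.ofReal_mul, this]
    · have : (⟨x b, b, rfl⟩ : Set.range x) ≠ ⟨x a, a, rfl⟩ :=
        fun h => hab (congrArg Subtype.val h).symm
      simp [hab, this]
  simp_rw [this]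
  exact psdArray_inner v

lemma exists_admissible2 {Λ : ℕ → ℂ × ℂ} (hΛ : ∀ i, Λ i ∈ biDisc) {n : ℕ}
    (hinj : Function.Injective fun i : Fin n => Λ i) {K : Fin n → Fin n → ℂ} (hK : PSDArray K)
    (hK₁ : PSDArray fun i j : Fin n => (1 - (Λ i).1 * (starRingEnd ℂ) (Λ j).1) * K i j)
    (hK₂ : PSDArray fun i j : Fin n => (1 - (Λ i).2 * (starRingEnd ℂ) (Λ j).2) * K i j)
    {ε : ℝ} (hε : 0 < ε) :
    ∃ k, Admissible2 Λ k ∧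
      ∀ i j : Fin n, k (Λ i) (Λ j) = K i j + if i = j then (ε : ℂ) else 0 := by
  classical
  let χ : Fin n → ℂ × ℂ → ℝ := fun i z => if z = Λ i then 1 else 0
  let k : ℂ × ℂ → ℂ × ℂ → ℂ := fun z w => (∑ i, ∑ j, (χ i z : ℂ) * χ j w * K i j) +
    if z = w then (ε : ℂ) else 0
  have diag : ∀ (v : ℂ), (1 - v * (starRingEnd ℂ) v) = ((1 - ‖v‖ ^ 2 : ℝ) : ℂ) := by
    intro v; rw [Complex.mul_conj, Complex.normSq_eq_norm_sq]; push_cast; rfl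
  have hk0 : PSDKernelOn biDisc k :=
    (psdKernelOn_of_array χ hK).add (psdKernelOn_diagonal (h := fun _ => ε) fun _ _ => hε.le)
  have hmul : ∀ u : ℂ × ℂ → ℂ, (∀ z ∈ biDisc, ‖u z‖ < 1) →
      (PSDArray fun i j : Fin n => (1 - u (Λ i) * (starRingEnd ℂ) (u (Λ j))) * K i j) →
      PSDKernelOn biDisc fun z w => (1 - u z * (starRingEnd ℂ) (u w)) * k z w := by
    intro u hu hA
    have h := (psdKernelOn_of_array (S := biDisc) χ hA).add
      (psdKernelOn_diagonal (S := biDisc) (h := fun z => (1 - ‖u z‖ ^ 2) * ε) fun z hz =>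
        mul_nonneg (by nlinarith [hu z hz, norm_nonneg (u z)]) hε.le)
    convert h using 3 with z w
    rw [mul_add, Finset.mul_sum]
    congr 1
    · refine Finset.sum_congr rfl fun i _ => ?_
      rw [Finset.mul_sum]
      refine Finset.sum_congr rfl fun j _ => ?_
      by_cases hz : z = Λ i
      · by_cases hw : w = Λ j
        · rw [← hz, ← hw]; ring
        · simp [χ, hw]
      · simp [χ, hz]
    · by_cases hzw : z = w
      · subst hzw
        simp only [if_true, diag]
        push_cast
        ring
      · simp [hzw]
  refine ⟨k, ⟨hk0, hmul Prod.fst (fun z hz => hz.1) hK₁, hmul Prod.snd (fun z hz => hz.2) hK₂,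
    fun m => ?_⟩, fun i j => ?_⟩
  · have h0 := (psdKernelOn_of_array (S := biDisc) χ hK).psdArray (ι := Unit)
      (fun _ => hΛ m) fun _ => 1
    simp only [Finset.univ_unique, Finset.sum_singleton, map_one, one_mul] at h0
    have h1 : (0 : ℂ) < ε := Complex.zero_lt_real.mpr hε
    simpa [k] using add_pos_of_nonneg_of_pos h0 h1
  · have hχ : ∀ i j : Fin n, χ i (Λ j) = if i = j then 1 else 0 := by
      intro i j
      simp only [χ]
      by_cases hij : i = j
      · simp [hij]
      · have : ¬ Λ j = Λ i := fun h => hij (hinj h).symm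
        simp [hij, this]
    have hij : Λ i = Λ j ↔ i = j := hinj.eq_iff
    have hsum : ∑ a, ∑ b, (χ a (Λ i) : ℂ) * χ b (Λ j) * K a b = K i j := by
      rw [Finset.sum_eq_single i, Finset.sum_eq_single j]
      · simp [hχ]
      · intro b _ hb
        simp [hχ, hb]
      · simp
      · intro a _ ha
        simp [hχ, ha]
      · simp
    simp only [k, hsum, hij]

lemma Admissible2.sum_gram2 {Λ : ℕ → ℂ × ℂ} {k : ℂ × ℂ → ℂ × ℂ → ℂ} (hk : Admissible2 Λ k)
    (n : ℕ) : ∑ i ∈ Finset.range n, ∑ j ∈ Finset.range n,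
      (starRingEnd ℂ) ((√(k (Λ i) (Λ i)).re : ℝ) : ℂ) * ((√(k (Λ j) (Λ j)).re : ℝ) : ℂ) *
        Gram2 Λ k i j = ∑ i : Fin n, ∑ j : Fin n, k (Λ i) (Λ j) := by
  rw [Finset.sum_range]
  refine Finset.sum_congr rfl fun i _ => ?_
  rw [Finset.sum_range]
  refine Finset.sum_congr rfl fun j _ => ?_
  have h : ∀ i, ((√(k (Λ i) (Λ i)).re : ℝ) : ℂ) ≠ 0 := fun i => by
    exact_mod_cast (Real.sqrt_pos.mpr (Complex.pos_iff.mp (hk.2.2.2 i)).1).ne'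
  have hi := h i
  have hj := h j
  rw [hk.gram2_eq, Complex.conj_ofReal, Complex.conj_ofReal]
  push_cast
  field_simp

lemma tendsto_add_mul_nhdsGT (a b : ℝ) : Tendsto (fun ε : ℝ => a + b * ε) (𝓝[>] 0) (𝓝 a) := by
  have : Continuous fun ε : ℝ => a + b * ε := by fun_prop
  have h := this.tendsto 0
  simp only [mul_zero, add_zero] at h
  exact h.mono_left nhdsWithin_le_nhds

lemma sum_re_perturb {n : ℕ} (K : Fin n → Fin n → ℂ) (ε : ℝ) :
    (∑ i, ∑ j, (K i j + if i = j then (ε : ℂ) else 0)).re = (∑ i, ∑ j, K i j).re + n * ε := by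
  simp [Finset.sum_add_distrib]

lemma le_sum_of_gram2_lower_bound {Λ : ℕ → ℂ × ℂ} (hΛ : ∀ i, Λ i ∈ biDisc) {N : ℝ}
    (h : ∀ k : ℂ × ℂ → ℂ × ℂ → ℂ, Admissible2 Λ k → ∀ (s : Finset ℕ) (α : ℕ → ℂ),
      (((N * ∑ i ∈ s, ‖α i‖ ^ 2 : ℝ)) : ℂ) ≤
        ∑ i ∈ s, ∑ j ∈ s, (starRingEnd ℂ) (α i) * α j * Gram2 Λ k i j)
    {n : ℕ} (hinj : Function.Injective fun i : Fin n => Λ i)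
    {K : Fin n → Fin n → ℂ} (hK : PSDArray K)
    (hK₁ : PSDArray fun i j : Fin n => (1 - (Λ i).1 * (starRingEnd ℂ) (Λ j).1) * K i j)
    (hK₂ : PSDArray fun i j : Fin n => (1 - (Λ i).2 * (starRingEnd ℂ) (Λ j).2) * K i j) :
    N * ∑ i, (K i i).re ≤ (∑ i, ∑ j, K i j).re := by
  have key : ∀ ε : ℝ, 0 < ε → N * ∑ i, (K i i).re + N * n * ε ≤ (∑ i, ∑ j, K i j).re + n * ε := by
    intro ε hε
    obtain ⟨k, hk, hkK⟩ := exists_admissible2 hΛ hinj hK hK₁ hK₂ hε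
    have h1 := h k hk (Finset.range n) fun i => ((√(k (Λ i) (Λ i)).re : ℝ) : ℂ)
    rw [hk.sum_gram2] at h1
    have h2 := (Complex.le_def.mp h1).1
    simp_rw [hkK] at h2
    rw [sum_re_perturb, Complex.ofReal_re, Finset.sum_range] at h2
    refine le_trans (le_of_eq ?_) h2
    rw [mul_assoc, ← mul_add]
    congr 1
    have : ∀ i : Fin n, ‖((√(k (Λ i) (Λ i)).re : ℝ) : ℂ)‖ ^ 2 = (K i i).re + ε := by
      intro i
      rw [Complex.norm_real, Real.norm_of_nonneg (Real.sqrt_nonneg _),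
        Real.sq_sqrt (Complex.pos_iff.mp (hk.2.2.2 i)).1.le, hkK]
      simp
    simp_rw [this, Finset.sum_add_distrib]
    simp
  exact le_of_tendsto_of_tendsto (tendsto_add_mul_nhdsGT _ _) (tendsto_add_mul_nhdsGT _ _)
    (eventually_nhdsWithin_of_forall fun ε hε => key ε hε)

lemma sum_le_of_gram2_upper_bound {Λ : ℕ → ℂ × ℂ} (hΛ : ∀ i, Λ i ∈ biDisc) {M : ℝ}
    (h : ∀ k : ℂ × ℂ → ℂ × ℂ → ℂ, Admissible2 Λ k → ∀ (s : Finset ℕ) (α : ℕ → ℂ),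
      ∑ i ∈ s, ∑ j ∈ s, (starRingEnd ℂ) (α i) * α j * Gram2 Λ k i j ≤
        (((M * ∑ i ∈ s, ‖α i‖ ^ 2 : ℝ)) : ℂ))
    {n : ℕ} (hinj : Function.Injective fun i : Fin n => Λ i)
    {K : Fin n → Fin n → ℂ} (hK : PSDArray K)
    (hK₁ : PSDArray fun i j : Fin n => (1 - (Λ i).1 * (starRingEnd ℂ) (Λ j).1) * K i j)
    (hK₂ : PSDArray fun i j : Fin n => (1 - (Λ i).2 * (starRingEnd ℂ) (Λ j).2) * K i j) :
    (∑ i, ∑ j, K i j).re ≤ M * ∑ i, (K i i).re := by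
  have key : ∀ ε : ℝ, 0 < ε → (∑ i, ∑ j, K i j).re + n * ε ≤ M * ∑ i, (K i i).re + M * n * ε := by
    intro ε hε
    obtain ⟨k, hk, hkK⟩ := exists_admissible2 hΛ hinj hK hK₁ hK₂ hε
    have h1 := h k hk (Finset.range n) fun i => ((√(k (Λ i) (Λ i)).re : ℝ) : ℂ)
    rw [hk.sum_gram2] at h1
    have h2 := (Complex.le_def.mp h1).1
    simp_rw [hkK] at h2
    rw [sum_re_perturb, Complex.ofReal_re, Finset.sum_range] at h2
    refine le_trans h2 (le_of_eq ?_)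
    rw [mul_assoc, ← mul_add]
    congr 1
    have : ∀ i : Fin n, ‖((√(k (Λ i) (Λ i)).re : ℝ) : ℂ)‖ ^ 2 = (K i i).re + ε := by
      intro i
      rw [Complex.norm_real, Real.norm_of_nonneg (Real.sqrt_nonneg _),
        Real.sq_sqrt (Complex.pos_iff.mp (hk.2.2.2 i)).1.le, hkK]
      simp
    simp_rw [this, Finset.sum_add_distrib]
    simp
  exact le_of_tendsto_of_tendsto (tendsto_add_mul_nhdsGT _ _) (tendsto_add_mul_nhdsGT _ _)
    (eventually_nhdsWithin_of_forall fun ε hε => key ε hε)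

lemma injective_of_gram2_lower_bound {Λ : ℕ → ℂ × ℂ} (hΛ : ∀ i, Λ i ∈ biDisc) {N : ℝ}
    (hN : 0 < N)
    (h : ∀ k : ℂ × ℂ → ℂ × ℂ → ℂ, Admissible2 Λ k → ∀ (s : Finset ℕ) (α : ℕ → ℂ),
      (((N * ∑ i ∈ s, ‖α i‖ ^ 2 : ℝ)) : ℂ) ≤
        ∑ i ∈ s, ∑ j ∈ s, (starRingEnd ℂ) (α i) * α j * Gram2 Λ k i j) :
    Function.Injective Λ := by
  intro i j hij
  by_contra hne
  obtain ⟨k, hk, -⟩ := exists_admissible2 (n := 0) (K := fun _ _ => 0) hΛ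
    (fun a => a.elim0) (fun c => by simp) (fun c => by simp) (fun c => by simp) zero_lt_one
  have h1 := h k hk {i, j} fun a => if a = i then 1 else -1
  have hG : Gram2 Λ k i j = 1 ∧ Gram2 Λ k j i = 1 ∧ Gram2 Λ k j j = 1 ∧ Gram2 Λ k i i = 1 := by
    have e := hk.gram2_self i
    simp only [Gram2] at e ⊢
    rw [← hij]
    exact ⟨e, e, e, e⟩
  have hne' : ¬ j = i := fun h => hne h.symm
  simp only [Finset.sum_pair hne, hG, if_true, if_neg hne'] at h1
  have h2 := (Complex.le_def.mp h1).1
  norm_num at h2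
  linarith

lemma exists_transfer_function {E H : Type*} [NormedAddCommGroup E] [InnerProductSpace ℂ E]
    [FiniteDimensional ℂ E] [NormedAddCommGroup H] [InnerProductSpace ℂ H]
    [FiniteDimensional ℂ H] (G : WithLp 2 (E × H) ≃ₗᵢ[ℂ] WithLp 2 (E × H))
    {S : Set (ℂ × ℂ)} {Z : ℂ × ℂ → H →L[ℂ] H} (hZ : DifferentiableOn ℂ Z S)
    (hZ₁ : ∀ z ∈ S, ‖Z z‖ < 1) :
    ∃ Ψ : ℂ × ℂ → E →L[ℂ] E, DifferentiableOn ℂ Ψ S ∧ (∀ z ∈ S, ‖Ψ z‖ ≤ 1) ∧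
      ∀ z ∈ S, ∀ u v h, G (WithLp.toLp 2 (u, Z z h)) = WithLp.toLp 2 (v, h) → Ψ z u = v := by
  have := FiniteDimensional.complete ℂ E
  have := FiniteDimensional.complete ℂ H
  let G' : WithLp 2 (E × H) →L[ℂ] WithLp 2 (E × H) := G.toContinuousLinearEquiv
  let e := WithLp.prodContinuousLinearEquiv 2 ℂ E H
  let g : E × H →L[ℂ] E × H := (e : _ →L[ℂ] E × H) ∘L G' ∘L (e.symm : E × H →L[ℂ] _)
  have hg : ∀ p, g p = (G (WithLp.toLp 2 p)).ofLp := fun p => rfl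
  have hnorm : ∀ u h, ‖(g (u, h)).1‖ ^ 2 + ‖(g (u, h)).2‖ ^ 2 = ‖u‖ ^ 2 + ‖h‖ ^ 2 := by
    intro u h
    have h1 := WithLp.prod_norm_sq_eq_of_L2 (G (WithLp.toLp 2 (u, h)))
    rw [G.norm_map, WithLp.prod_norm_sq_eq_of_L2] at h1
    exact h1.symm
  let A : E →L[ℂ] E := .fst ℂ E H ∘L g ∘L .inl ℂ E H
  let B : H →L[ℂ] E := .fst ℂ E H ∘L g ∘L .inr ℂ E H
  let C : E →L[ℂ] H := .snd ℂ E H ∘L g ∘L .inl ℂ E H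
  let D : H →L[ℂ] H := .snd ℂ E H ∘L g ∘L .inr ℂ E H
  have hg1 : ∀ u h, (g (u, h)).1 = A u + B h := by
    intro u h
    have : ((u, h) : E × H) = (u, 0) + (0, h) := by simp
    rw [this, map_add]; rfl
  have hg2 : ∀ u h, (g (u, h)).2 = C u + D h := by
    intro u h
    have : ((u, h) : E × H) = (u, 0) + (0, h) := by simp
    rw [this, map_add]; rfl
  have hD : ‖D‖ ≤ 1 := by
    refine D.opNorm_le_bound zero_le_one fun h => ?_
    have h1 := hnorm 0 h
    rw [hg2] at h1
    simp only [map_zero, zero_add, norm_zero] at h1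
    rw [one_mul]
    refine le_of_sq_le_sq ?_ (norm_nonneg _)
    nlinarith [sq_nonneg ‖(g (0, h)).1‖]
  have hunit : ∀ z ∈ S, IsUnit (1 - D * Z z) := by
    intro z hz
    refine isUnit_one_sub_of_norm_lt_one ?_
    calc ‖D * Z z‖ ≤ ‖D‖ * ‖Z z‖ := norm_mul_le _ _
      _ ≤ 1 * ‖Z z‖ := by gcongr
      _ < 1 := by rw [one_mul]; exact hZ₁ z hz
  have hdiff : DifferentiableOn ℂ (fun z => Ring.inverse (1 - D * Z z)) S := by
    intro z hz
    have h1 : DifferentiableWithinAt ℂ (fun z => 1 - D * Z z) S z :=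
      ((hZ z hz).const_mul D).const_sub 1
    obtain ⟨w, hw⟩ := hunit z hz
    have h2 : DifferentiableAt ℂ Ring.inverse (1 - D * Z z) := hw ▸ differentiableAt_inverse w.isUnit
    exact h2.comp_differentiableWithinAt z h1
  refine ⟨fun z => A + B ∘L Z z ∘L Ring.inverse (1 - D * Z z) ∘L C, ?_, ?_, ?_⟩
  · refine DifferentiableOn.const_add _ ?_
    exact (differentiableOn_const B).clm_comp
      (hZ.clm_comp (hdiff.clm_comp (differentiableOn_const C)))
  · intro z hz
    refine ContinuousLinearMap.opNorm_le_bound _ zero_le_one fun u => ?_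
    set h := Ring.inverse (1 - D * Z z) (C u) with hh
    have h1 : h = C u + D (Z z h) := by
      have h2 : h - D (Z z h) = C u :=
        congrArg (fun T : H →L[ℂ] H => T (C u)) (Ring.mul_inverse_cancel _ (hunit z hz))
      exact sub_eq_iff_eq_add.mp h2
    have h3 := hnorm u (Z z h)
    rw [hg1, hg2, ← h1] at h3
    have h4 : ‖Z z h‖ ≤ ‖h‖ := ((Z z).le_opNorm h).trans
      (mul_le_of_le_one_left (norm_nonneg _) (hZ₁ z hz).le)
    change ‖A u + B (Z z h)‖ ≤ 1 * ‖u‖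
    rw [one_mul]
    refine le_of_sq_le_sq ?_ (norm_nonneg _)
    nlinarith [norm_nonneg (Z z h), norm_nonneg h]
  · intro z hz u v h hG
    have h0 : g (u, Z z h) = (v, h) := by rw [hg, hG]
    have h1 := hg1 u (Z z h)
    have h2 := hg2 u (Z z h)
    rw [h0] at h1 h2
    have h3 : Ring.inverse (1 - D * Z z) (C u) = h := by
      have h4 : Ring.inverse (1 - D * Z z) (h - D (Z z h)) = h :=
        congrArg (fun T : H →L[ℂ] H => T h) (Ring.inverse_mul_cancel _ (hunit z hz))
      have h5 : C u = h - D (Z z h) := by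
        rw [eq_sub_iff_add_eq]; exact h2.symm
      rw [h5]
      exact h4
    change A u + B (Z z (Ring.inverse (1 - D * Z z) (C u))) = v
    rw [h3]
    exact h1.symm

lemma exists_holomorphic_contraction_of_inner {ι E : Type*} [Fintype ι] [NormedAddCommGroup E]
    [InnerProductSpace ℂ E] [FiniteDimensional ℂ E] {x : ι → ℂ × ℂ} (hx : ∀ i, x i ∈ biDisc)
    {u v b d : ι → E}
    (h : ∀ i j, inner ℂ (u j) (u i) - inner ℂ (v j) (v i) =
      (1 - (x i).1 * (starRingEnd ℂ) (x j).1) * inner ℂ (b j) (b i) +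
      (1 - (x i).2 * (starRingEnd ℂ) (x j).2) * inner ℂ (d j) (d i)) :
    ∃ Ψ : ℂ × ℂ → E →L[ℂ] E, DifferentiableOn ℂ Ψ biDisc ∧ (∀ z ∈ biDisc, ‖Ψ z‖ ≤ 1) ∧
      ∀ i, Ψ (x i) (u i) = v i := by
  let e := WithLp.prodContinuousLinearEquiv 2 ℂ E E
  let P₁ : WithLp 2 (E × E) →L[ℂ] WithLp 2 (E × E) := (e.symm : E × E →L[ℂ] WithLp 2 (E × E)) ∘L .inl ℂ E E ∘L .fst ℂ E E ∘L (e : WithLp 2 (E × E) →L[ℂ] E × E)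
  let P₂ : WithLp 2 (E × E) →L[ℂ] WithLp 2 (E × E) := (e.symm : E × E →L[ℂ] WithLp 2 (E × E)) ∘L .inr ℂ E E ∘L .snd ℂ E E ∘L (e : WithLp 2 (E × E) →L[ℂ] E × E)
  let Z : ℂ × ℂ → WithLp 2 (E × E) →L[ℂ] WithLp 2 (E × E) := fun z => z.1 • P₁ + z.2 • P₂
  have hZ : ∀ z p q, Z z (WithLp.toLp 2 (p, q)) = WithLp.toLp 2 (z.1 • p, z.2 • q) := by
    intro z p q
    refine WithLp.ofLp_injective 2 (Prod.ext ?_ ?_)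
    · change z.1 • p + z.2 • (0 : E) = z.1 • p
      simp
    · change z.1 • (0 : E) + z.2 • q = z.2 • q
      simp
  have hZd : Differentiable ℂ Z := by
    have h₁ : Differentiable ℂ fun z : ℂ × ℂ => z.1 := differentiable_fst
    have h₂ : Differentiable ℂ fun z : ℂ × ℂ => z.2 := differentiable_snd
    exact (h₁.smul_const P₁).add (h₂.smul_const P₂)
  have hZn : ∀ z ∈ biDisc, ‖Z z‖ < 1 := by
    intro z hz
    refine (ContinuousLinearMap.opNorm_le_bound _ (le_max_of_le_left (norm_nonneg z.1))
      fun p => ?_).trans_lt (max_lt hz.1 hz.2)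
    obtain ⟨p, q⟩ := p
    rw [hZ]
    refine le_of_sq_le_sq ?_ (by positivity)
    rw [mul_pow, WithLp.prod_norm_sq_eq_of_L2, WithLp.prod_norm_sq_eq_of_L2]
    simp only [WithLp.toLp_fst, WithLp.toLp_snd, norm_smul, mul_pow, mul_add]
    exact add_le_add
      (mul_le_mul_of_nonneg_right (pow_le_pow_left₀ (norm_nonneg _) (le_max_left _ _) 2)
        (sq_nonneg _))
      (mul_le_mul_of_nonneg_right (pow_le_pow_left₀ (norm_nonneg _) (le_max_right _ _) 2)
        (sq_nonneg _))
  let X : ι → WithLp 2 (E × WithLp 2 (E × E)) := fun i =>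
    WithLp.toLp 2 (u i, WithLp.toLp 2 ((x i).1 • b i, (x i).2 • d i))
  let Y : ι → WithLp 2 (E × WithLp 2 (E × E)) := fun i => WithLp.toLp 2 (v i, WithLp.toLp 2 (b i, d i))
  have hXY : ∀ i j, inner ℂ (X j) (X i) = inner ℂ (Y j) (Y i) := by
    intro i j
    simp only [X, Y, WithLp.prod_inner_apply, inner_smul_left, inner_smul_right]
    linear_combination h i j
  obtain ⟨G, hG⟩ := exists_linearIsometryEquiv_of_norm_eq (Fintype.linearCombination ℂ X)
    (Fintype.linearCombination ℂ Y) (by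
      intro c
      simp only [Fintype.linearCombination_apply]
      have h1 := sum_mul_conj_inner X c
      simp_rw [hXY] at h1
      rw [sum_mul_conj_inner Y c] at h1
      have h2 := Complex.ofReal_injective h1
      exact ((sq_eq_sq₀ (norm_nonneg _) (norm_nonneg _)).mp h2).symm)
  obtain ⟨Ψ, h₁, h₂, h₃⟩ := exists_transfer_function G hZd.differentiableOn hZn
  refine ⟨Ψ, h₁, h₂, fun i => h₃ _ (hx i) _ _ (WithLp.toLp 2 (b i, d i)) ?_⟩
  classical
  have := hG (Pi.single i 1)
  simpa [Fintype.linearCombination_apply_single, hZ, X, Y] using this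

lemma inner_single_ofReal_single_ofReal {ι : Type*} [Fintype ι] [DecidableEq ι] (i j : ι)
    (a : ℝ) :
    inner ℂ (EuclideanSpace.single j (a : ℂ)) (EuclideanSpace.single i (a : ℂ)) =
      if i = j then ((a * a : ℝ) : ℂ) else 0 := by
  rw [EuclideanSpace.inner_single_left, Complex.conj_ofReal]
  by_cases hij : i = j
  · subst hij
    simp
  · simp [hij, Ne.symm hij]

lemma exists_holomorphic_contraction_of_mem_aglerCone {ι : Type*} [Fintype ι] {x : ι → ℂ × ℂ}
    (hx : ∀ i, x i ∈ biDisc) {u v : ι → EuclideanSpace ℂ ι}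
    (h : (fun i j => inner ℂ (u j) (u i) - inner ℂ (v j) (v i)) ∈ aglerCone x) :
    ∃ Ψ : ℂ × ℂ → EuclideanSpace ℂ ι →L[ℂ] EuclideanSpace ℂ ι, DifferentiableOn ℂ Ψ biDisc ∧
      (∀ z ∈ biDisc, ‖Ψ z‖ ≤ 1) ∧ ∀ i, Ψ (x i) (u i) = v i := by
  obtain ⟨Γ, Δ, hΓ, hΔ, h⟩ := h
  obtain ⟨b, hb⟩ := hΓ.exists_gram
  obtain ⟨d, hd⟩ := hΔ.exists_gram
  refine exists_holomorphic_contraction_of_inner hx (b := b) (d := d) fun i j => ?_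
  rw [← hb, ← hd]
  exact h i j

lemma exists_dual_row_of_lower_bound {n : ℕ} {x : Fin (n + 1) → ℂ × ℂ}
    (hx : ∀ i, x i ∈ biDisc) {N : ℝ} (hN : 0 ≤ N)
    (h : ∀ K : Fin (n + 1) → Fin (n + 1) → ℂ, PSDArray K →
      (PSDArray fun i j => (1 - (x i).1 * (starRingEnd ℂ) (x j).1) * K i j) →
      (PSDArray fun i j => (1 - (x i).2 * (starRingEnd ℂ) (x j).2) * K i j) →
      N * ∑ i, (K i i).re ≤ (∑ i, ∑ j, K i j).re) :
    ∃ φ : Fin (n + 1) → ℂ × ℂ → ℂ, (∀ m, DifferentiableOn ℂ (φ m) biDisc) ∧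
      (∀ z ∈ biDisc, ∑ m, ‖φ m z‖ ^ 2 ≤ 1) ∧
      ∀ m i, φ m (x i) = if m = i then (√N : ℂ) else 0 := by
  let u : Fin (n + 1) → EuclideanSpace ℂ (Fin (n + 1)) := fun _ => EuclideanSpace.single 0 1
  let v : Fin (n + 1) → EuclideanSpace ℂ (Fin (n + 1)) := fun i => EuclideanSpace.single i (√N : ℂ)
  have huv : ∀ i j, inner ℂ (u j) (u i) - inner ℂ (v j) (v i) =
      1 - if i = j then (N : ℂ) else 0 := by
    intro i j
    simp only [u, v]
    rw [inner_single_ofReal_single_ofReal, Real.mul_self_sqrt hN]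
    simp
  obtain ⟨Ψ, h₁, h₂, h₃⟩ := exists_holomorphic_contraction_of_mem_aglerCone hx (u := u) (v := v) <|
    mem_aglerCone_of_forall_nonneg hx
    (fun i j => by
      simp only [huv, map_sub, map_one, apply_ite (starRingEnd ℂ), Complex.conj_ofReal, map_zero,
        eq_comm])
    (fun K hK hK₁ hK₂ => by
      have h4 := h K hK hK₁ hK₂
      simp only [huv, sub_mul, one_mul, ite_mul, zero_mul, Finset.sum_sub_distrib,
        Finset.sum_ite_eq, Finset.mem_univ, if_true, ← Finset.mul_sum, Complex.sub_re,
        Complex.re_ofReal_mul, Complex.re_sum] at h4 ⊢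
      linarith)
  refine ⟨fun m z => Ψ z (EuclideanSpace.single 0 1) m, fun m => ?_, fun z hz => ?_, fun m i => ?_⟩
  · exact (EuclideanSpace.proj m : EuclideanSpace ℂ (Fin (n + 1)) →L[ℂ] ℂ).differentiable.comp_differentiableOn
      (h₁.clm_apply (differentiableOn_const _))
  · rw [← EuclideanSpace.norm_sq_eq]
    have h5 := (Ψ z).le_of_opNorm_le (h₂ z hz) (EuclideanSpace.single 0 1)
    simp only [PiLp.norm_single, norm_one, mul_one] at h5
    exact pow_le_one₀ (norm_nonneg _) h5
  · have h5 := congrArg (fun y : EuclideanSpace ℂ (Fin (n + 1)) => y m) (h₃ i)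
    simpa [u, v, Pi.single_apply] using h5

lemma exists_dual_column_of_upper_bound {n : ℕ} {x : Fin (n + 1) → ℂ × ℂ}
    (hx : ∀ i, x i ∈ biDisc) {M : ℝ} (hM : 0 < M)
    (h : ∀ K : Fin (n + 1) → Fin (n + 1) → ℂ, PSDArray K →
      (PSDArray fun i j => (1 - (x i).1 * (starRingEnd ℂ) (x j).1) * K i j) →
      (PSDArray fun i j => (1 - (x i).2 * (starRingEnd ℂ) (x j).2) * K i j) →
      (∑ i, ∑ j, K i j).re ≤ M * ∑ i, (K i i).re) :
    ∃ ψ : Fin (n + 1) → ℂ × ℂ → ℂ, (∀ m, DifferentiableOn ℂ (ψ m) biDisc) ∧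
      (∀ z ∈ biDisc, ∑ m, ‖ψ m z‖ ^ 2 ≤ 1) ∧ ∀ i, √M * ψ i (x i) = 1 := by
  let u : Fin (n + 1) → EuclideanSpace ℂ (Fin (n + 1)) := fun i => EuclideanSpace.single i (√M : ℂ)
  let v : Fin (n + 1) → EuclideanSpace ℂ (Fin (n + 1)) := fun _ => EuclideanSpace.single 0 1
  have huv : ∀ i j, inner ℂ (u j) (u i) - inner ℂ (v j) (v i) =
      (if i = j then (M : ℂ) else 0) - 1 := by
    intro i j
    simp only [u, v]
    rw [inner_single_ofReal_single_ofReal, Real.mul_self_sqrt hM.le]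
    simp
  obtain ⟨Ψ, h₁, h₂, h₃⟩ := exists_holomorphic_contraction_of_mem_aglerCone hx (u := u) (v := v) <|
    mem_aglerCone_of_forall_nonneg hx
    (fun i j => by
      simp only [huv, map_sub, map_one, apply_ite (starRingEnd ℂ), Complex.conj_ofReal, map_zero,
        eq_comm])
    (fun K hK hK₁ hK₂ => by
      have h4 := h K hK hK₁ hK₂
      simp only [huv, sub_mul, one_mul, ite_mul, zero_mul, Finset.sum_sub_distrib,
        Finset.sum_ite_eq, Finset.mem_univ, if_true, ← Finset.mul_sum, Complex.sub_re,
        Complex.re_ofReal_mul, Complex.re_sum] at h4 ⊢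
      linarith)
  let e : EuclideanSpace ℂ (Fin (n + 1)) := EuclideanSpace.single 0 1
  refine ⟨fun m z => Ψ z (EuclideanSpace.single m 1) 0, fun m => ?_, fun z hz => ?_, fun i => ?_⟩
  · exact (EuclideanSpace.proj 0 : EuclideanSpace ℂ (Fin (n + 1)) →L[ℂ] ℂ).differentiable.comp_differentiableOn
      (h₁.clm_apply (differentiableOn_const _))
  · have h5 : ∀ m, ‖Ψ z (EuclideanSpace.single m 1) 0‖ =
        ‖(ContinuousLinearMap.adjoint (Ψ z) e) m‖ := by
      intro m
      have h6 := ContinuousLinearMap.adjoint_inner_right (Ψ z) (EuclideanSpace.single m 1) e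
      simp only [e, EuclideanSpace.inner_single_left, EuclideanSpace.inner_single_right, map_one,
        one_mul] at h6
      rw [h6, RCLike.norm_conj]
    simp only [h5]
    rw [← EuclideanSpace.norm_sq_eq]
    have h6 := (ContinuousLinearMap.adjoint (Ψ z)).le_of_opNorm_le
      ((LinearIsometryEquiv.norm_map _ _).trans_le (h₂ z hz)) e
    simp only [e, PiLp.norm_single, norm_one, mul_one] at h6
    exact pow_le_one₀ (norm_nonneg _) h6
  · have h5 := congrArg (fun y : EuclideanSpace ℂ (Fin (n + 1)) => y 0) (h₃ i)
    have h6 : u i = (√M : ℂ) • EuclideanSpace.single i 1 := by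
      ext a
      simp [u]
    rw [h6, map_smul] at h5
    simpa [v] using h5

lemma interpolating_of_dual_families {Λ : ℕ → ℂ × ℂ} (hΛ : ∀ i, Λ i ∈ biDisc) {C : ℝ}
    (h : ∀ n : ℕ, ∃ F : Fin (n + 1) → ℂ × ℂ → ℂ, (∀ m, DifferentiableOn ℂ (F m) biDisc) ∧
      (∀ z ∈ biDisc, ∑ m, ‖F m z‖ ≤ C) ∧
      ∀ m i : Fin (n + 1), F m (Λ i) = if m = i then 1 else 0)
    {w : ℕ → ℂ} (hw : BddAbove (Set.range fun i => ‖w i‖)) :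
    ∃ f : ℂ × ℂ → ℂ, DifferentiableOn ℂ f biDisc ∧
      (∃ B : ℝ, ∀ z ∈ biDisc, ‖f z‖ ≤ B) ∧ ∀ i, f (Λ i) = w i := by
  choose F hF₁ hF₂ hF₃ using h
  obtain ⟨W, hW⟩ := hw
  have hW' : ∀ i, ‖w i‖ ≤ W := fun i => hW ⟨i, rfl⟩
  have hW₀ : 0 ≤ W := (norm_nonneg _).trans (hW' 0)
  obtain ⟨f, h₁, h₂, h₃⟩ := montel_biDisc (B := W * C) (hyperfilter ℕ)
    (f := fun n z => ∑ m : Fin (n + 1), w m * F n m z)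
    (fun n => DifferentiableOn.fun_sum fun m _ => (hF₁ n m).const_mul _)
    (fun n z hz => calc
      ‖∑ m : Fin (n + 1), w m * F n m z‖ ≤ ∑ m : Fin (n + 1), W * ‖F n m z‖ := by
        refine (norm_sum_le _ _).trans (Finset.sum_le_sum fun m _ => ?_)
        rw [norm_mul]
        exact mul_le_mul_of_nonneg_right (hW' m) (norm_nonneg _)
      _ ≤ W * C := by
        rw [← Finset.mul_sum]
        exact mul_le_mul_of_nonneg_left (hF₂ n z hz) hW₀)
  refine ⟨f, h₁, ⟨W * C, h₂⟩, fun i => ?_⟩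
  refine tendsto_nhds_unique (h₃ _ (hΛ i)) (tendsto_const_nhds.congr' ?_)
  have hle : (hyperfilter ℕ : Filter ℕ) ≤ atTop := Nat.hyperfilter_le_atTop
  filter_upwards [hle (eventually_ge_atTop i)] with n hn
  have h4 := hF₃ n
  rw [Finset.sum_eq_single (⟨i, Nat.lt_succ_of_le hn⟩ : Fin (n + 1))]
  · have h5 := h4 ⟨i, Nat.lt_succ_of_le hn⟩ ⟨i, Nat.lt_succ_of_le hn⟩
    simp only [if_true] at h5
    rw [h5, mul_one]
  · intro m _ hm
    have h5 := h4 m ⟨i, Nat.lt_succ_of_le hn⟩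
    simp only [if_neg hm] at h5
    rw [h5, mul_zero]
  · simp

lemma interpolating_of_gram2_lower_bound {Λ : ℕ → ℂ × ℂ} (hΛ : ∀ i, Λ i ∈ biDisc) {N : ℝ}
    (hN : 0 < N)
    (h : ∀ k : ℂ × ℂ → ℂ × ℂ → ℂ, Admissible2 Λ k → ∀ (s : Finset ℕ) (α : ℕ → ℂ),
      (((N * ∑ i ∈ s, ‖α i‖ ^ 2 : ℝ)) : ℂ) ≤
        ∑ i ∈ s, ∑ j ∈ s, (starRingEnd ℂ) (α i) * α j * Gram2 Λ k i j)
    {w : ℕ → ℂ} (hw : BddAbove (Set.range fun i => ‖w i‖)) :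
    ∃ f : ℂ × ℂ → ℂ, DifferentiableOn ℂ f biDisc ∧
      (∃ B : ℝ, ∀ z ∈ biDisc, ‖f z‖ ≤ B) ∧ ∀ i, f (Λ i) = w i := by
  have hinj := injective_of_gram2_lower_bound hΛ hN h
  refine interpolating_of_dual_families hΛ (C := N⁻¹) (fun n => ?_) hw
  obtain ⟨φ, h₁, h₂, h₃⟩ := exists_dual_row_of_lower_bound (n := n) (x := fun i => Λ i)
    (fun i => hΛ i) hN.le fun K hK hK₁ hK₂ => le_sum_of_gram2_lower_bound hΛ h
      (hinj.comp Fin.val_injective) hK hK₁ hK₂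
  refine ⟨fun m z => (N⁻¹ : ℝ) * φ m z ^ 2, fun m => ((h₁ m).pow 2).const_mul _, fun z hz => ?_,
    fun m i => ?_⟩
  · simp only [norm_mul, norm_pow, ← Finset.mul_sum, Complex.norm_real]
    rw [Real.norm_of_nonneg (by positivity)]
    exact mul_le_of_le_one_right (by positivity) (h₂ z hz)
  · beta_reduce
    rw [h₃]
    split_ifs
    · rw [← Complex.ofReal_pow, Real.sq_sqrt hN.le, ← Complex.ofReal_mul, inv_mul_cancel₀ hN.ne',
        Complex.ofReal_one]
    · simp

lemma interpolating_of_gram2_upper_bound {Λ : ℕ → ℂ × ℂ} (hΛ : ∀ i, Λ i ∈ biDisc) {R : ℝ}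
    (hR : 0 < R) {φ : ℕ → ℂ × ℂ → ℂ}
    (hφ : ∀ i, DifferentiableOn ℂ (φ i) biDisc ∧ (∀ z ∈ biDisc, ‖φ i z‖ ≤ R) ∧
      φ i (Λ i) = 1 ∧ ∀ n, n ≠ i → φ i (Λ n) = 0)
    {M : ℝ} (hM : 0 < M)
    (h : ∀ k : ℂ × ℂ → ℂ × ℂ → ℂ, Admissible2 Λ k → ∀ (s : Finset ℕ) (α : ℕ → ℂ),
      ∑ i ∈ s, ∑ j ∈ s, (starRingEnd ℂ) (α i) * α j * Gram2 Λ k i j ≤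
        (((M * ∑ i ∈ s, ‖α i‖ ^ 2 : ℝ)) : ℂ))
    {w : ℕ → ℂ} (hw : BddAbove (Set.range fun i => ‖w i‖)) :
    ∃ f : ℂ × ℂ → ℂ, DifferentiableOn ℂ f biDisc ∧
      (∃ B : ℝ, ∀ z ∈ biDisc, ‖f z‖ ≤ B) ∧ ∀ i, f (Λ i) = w i := by
  have hinj : Function.Injective Λ := by
    intro i j hij
    by_contra hne
    have h1 := (hφ i).2.2.2 j (Ne.symm hne)
    rw [← hij, (hφ i).2.2.1] at h1
    exact one_ne_zero h1
  refine interpolating_of_dual_families hΛ (C := M * R) (fun n => ?_) hw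
  obtain ⟨ψ, h₁, h₂, h₃⟩ := exists_dual_column_of_upper_bound (n := n) (x := fun i => Λ i)
    (fun i => hΛ i) hM fun K hK hK₁ hK₂ => sum_le_of_gram2_upper_bound hΛ h
      (hinj.comp Fin.val_injective) hK hK₁ hK₂
  refine ⟨fun m z => φ m z * (√M * ψ m z) ^ 2,
    fun m => (hφ m).1.mul (((h₁ m).const_mul _).pow 2), fun z hz => ?_, fun m i => ?_⟩
  · calc ∑ m : Fin (n + 1), ‖φ m z * (√M * ψ m z) ^ 2‖
        ≤ ∑ m : Fin (n + 1), M * R * ‖ψ m z‖ ^ 2 := by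
          refine Finset.sum_le_sum fun m _ => ?_
          rw [norm_mul, norm_pow, norm_mul, mul_pow, Complex.norm_real,
            Real.norm_of_nonneg (Real.sqrt_nonneg _), Real.sq_sqrt hM.le, ← mul_assoc, mul_comm M]
          gcongr
          exact (hφ m).2.1 z hz
      _ ≤ M * R := by
          rw [← Finset.mul_sum]
          exact mul_le_of_le_one_right (by positivity) (h₂ z hz)
  · beta_reduce
    split_ifs with hmi
    · subst hmi
      rw [h₃, (hφ m).2.2.1]
      norm_num
    · rw [(hφ m).2.2.2 i fun h => hmi (Fin.ext h.symm), zero_mul]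

theorem stmt_14 (Λ : ℕ → ℂ × ℂ) (hΛ : ∀ i, Λ i ∈ biDisc) :
    -- (i) ↔ (ii)
    ((∀ w : ℕ → ℂ, BddAbove (Set.range fun i => ‖w i‖) →
        ∃ f : ℂ × ℂ → ℂ, DifferentiableOn ℂ f biDisc ∧
          (∃ B : ℝ, ∀ z ∈ biDisc, ‖f z‖ ≤ B) ∧ ∀ i, f (Λ i) = w i) ↔
      (∃ M : ℝ, 0 < M ∧ ∃ N : ℝ, 0 < N ∧
        ∀ k : ℂ × ℂ → ℂ × ℂ → ℂ, Admissible2 Λ k →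
          ∀ (s : Finset ℕ) (α : ℕ → ℂ),
            (((N * ∑ i ∈ s, ‖α i‖ ^ 2 : ℝ)) : ℂ) ≤
              ∑ i ∈ s, ∑ j ∈ s, (starRingEnd ℂ) (α i) * α j * Gram2 Λ k i j ∧
            ∑ i ∈ s, ∑ j ∈ s, (starRingEnd ℂ) (α i) * α j * Gram2 Λ k i j ≤
              (((M * ∑ i ∈ s, ‖α i‖ ^ 2 : ℝ)) : ℂ))) ∧
    -- (i) ↔ (iii)
    ((∀ w : ℕ → ℂ, BddAbove (Set.range fun i => ‖w i‖) →
        ∃ f : ℂ × ℂ → ℂ, DifferentiableOn ℂ f biDisc ∧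
          (∃ B : ℝ, ∀ z ∈ biDisc, ‖f z‖ ≤ B) ∧ ∀ i, f (Λ i) = w i) ↔
      ((∃ M : ℝ, 0 < M ∧ ∃ φ : ℕ → ℂ × ℂ → ℂ, ∀ i,
          DifferentiableOn ℂ (φ i) biDisc ∧ (∀ z ∈ biDisc, ‖φ i z‖ ≤ M) ∧
          φ i (Λ i) = 1 ∧ ∀ n, n ≠ i → φ i (Λ n) = 0) ∧
        (∃ M : ℝ, 0 < M ∧
          ∀ k : ℂ × ℂ → ℂ × ℂ → ℂ, Admissible2 Λ k →
            ∀ (s : Finset ℕ) (α : ℕ → ℂ),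
              ∑ i ∈ s, ∑ j ∈ s, (starRingEnd ℂ) (α i) * α j * Gram2 Λ k i j ≤
                (((M * ∑ i ∈ s, ‖α i‖ ^ 2 : ℝ)) : ℂ)))) ∧
    -- (i) ↔ (iv)
    ((∀ w : ℕ → ℂ, BddAbove (Set.range fun i => ‖w i‖) →
        ∃ f : ℂ × ℂ → ℂ, DifferentiableOn ℂ f biDisc ∧
          (∃ B : ℝ, ∀ z ∈ biDisc, ‖f z‖ ≤ B) ∧ ∀ i, f (Λ i) = w i) ↔
      (∃ N : ℝ, 0 < N ∧
        ∀ k : ℂ × ℂ → ℂ × ℂ → ℂ, Admissible2 Λ k →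
          ∀ (s : Finset ℕ) (α : ℕ → ℂ),
            (((N * ∑ i ∈ s, ‖α i‖ ^ 2 : ℝ)) : ℂ) ≤
              ∑ i ∈ s, ∑ j ∈ s, (starRingEnd ℂ) (α i) * α j * Gram2 Λ k i j)) := by
  have of_lower := fun h : ∃ N : ℝ, 0 < N ∧ ∀ k : ℂ × ℂ → ℂ × ℂ → ℂ, Admissible2 Λ k →
      ∀ (s : Finset ℕ) (α : ℕ → ℂ), (((N * ∑ i ∈ s, ‖α i‖ ^ 2 : ℝ)) : ℂ) ≤
        ∑ i ∈ s, ∑ j ∈ s, (starRingEnd ℂ) (α i) * α j * Gram2 Λ k i j =>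
    fun (w : ℕ → ℂ) (hw : BddAbove (Set.range fun i => ‖w i‖)) =>
      h.elim fun _ hN => interpolating_of_gram2_lower_bound hΛ hN.1 hN.2 hw
  refine ⟨⟨fun h => ?_, fun ⟨_, _, N, hN, h⟩ => of_lower ⟨N, hN, fun k hk s α => (h k hk s α).1⟩⟩,
    ⟨fun h => ?_, ?_⟩, ⟨fun h => ?_, of_lower⟩⟩
  · obtain ⟨M, hM, hs⟩ := exists_uniform_sign_interpolation hΛ h
    exact ⟨M ^ 2, by positivity, (M ^ 2)⁻¹, by positivity,
      fun k hk s α => gram2_bounds hΛ hM hs hk s α⟩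
  · obtain ⟨M, hM, hs⟩ := exists_uniform_sign_interpolation hΛ h
    exact ⟨⟨M, hM, strongly_separated_of_signs hs⟩, M ^ 2, by positivity,
      fun k hk s α => (gram2_bounds hΛ hM hs hk s α).2⟩
  · rintro ⟨⟨R, hR, φ, hφ⟩, M, hM, h⟩ w hw
    exact interpolating_of_gram2_upper_bound hΛ hR hφ hM h hw
  · obtain ⟨M, hM, hs⟩ := exists_uniform_sign_interpolation hΛ h
    exact ⟨(M ^ 2)⁻¹, by positivity, fun k hk s α => (gram2_bounds hΛ hM hs hk s α).1⟩
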